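/- arXiv:0806.3668 — 12 statements merged into one kernel-verified Lean document; each statement's English description precedes it below -/
import Mathlib

section
/- For every integer k ≥ 2, every undirected cycle cover C with k objectives (every cycle has at least 3 edges) such that every edge e of C satisfies w(e) ≤ (1/k)·w(C) componentwise possesses a (1/k)-decomposition, i.e., a collection of paths P ⊆ C with w(P) ≥ (1/k)·w(C) componentwise. (In the paper's notation, α_k^u ≥ 1/k.) -/
theorem Finset.add_le_sum_of_mem_of_ne {α : Type*} [DecidableEq α] {s : Finset α} {f : α → ℝ}
    (hf : ∀ e, 0 ≤ f e) {a b : α} (ha : a ∈ s) (hb : b ∈ s) (hab : a ≠ b) :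
    f a + f b ≤ ∑ e ∈ s, f e := by
  rw [← Finset.sum_pair hab]
  refine Finset.sum_le_sum_of_subset_of_nonneg ?_ fun e _ _ => hf e
  intro x hx
  simp only [Finset.mem_insert, Finset.mem_singleton] at hx
  rcases hx with rfl | rfl <;> assumption

/-- Either some element carries at most half of the total weight in every objective, or there are
exactly `k` elements and every objective has an element carrying more than half of its weight. -/
theorem exists_light_or_majority {α : Type*} [DecidableEq α] {k : ℕ} {s : Finset α}
    {w : α → Fin k → ℝ} (hw : ∀ e i, 0 ≤ w e i) (hk : k ≤ s.card) :
    (∃ e ∈ s, ∀ i, 2 * w e i ≤ ∑ e' ∈ s, w e' i) ∨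
      (k = s.card ∧ ∀ i, ∃ e ∈ s, ∑ e' ∈ s, w e' i < 2 * w e i) := by
  by_cases h : ∃ e ∈ s, ∀ i, 2 * w e i ≤ ∑ e' ∈ s, w e' i
  · exact Or.inl h
  right
  push Not at h
  obtain rfl | ⟨e₀, he₀⟩ := s.eq_empty_or_nonempty
  · obtain rfl : k = 0 := by simpa using hk
    exact ⟨rfl, fun i => i.elim0⟩
  have : Nonempty (Fin k) := ⟨(h e₀ he₀).choose⟩
  choose! g hg using h
  have hinj : Set.InjOn g s := by
    intro a ha b hb hab
    by_contra hne
    have h1 := Finset.add_le_sum_of_mem_of_ne (fun e => hw e (g a)) ha hb hne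
    have h2 := hg a ha
    have h3 := hg b hb
    rw [← hab] at h3
    linarith
  have himg : (s.image g).card = s.card := Finset.card_image_of_injOn hinj
  have hle : (s.image g).card ≤ k := by simpa using Finset.card_le_univ (s.image g)
  have hks : k = s.card := by omega
  refine ⟨hks, fun i => ?_⟩
  have huniv : s.image g = Finset.univ := by
    rw [← Finset.card_eq_iff_eq_univ]
    simp [himg, hks.symm]
  have hi : i ∈ s.image g := huniv ▸ Finset.mem_univ i
  obtain ⟨e, he, rfl⟩ := Finset.mem_image.1 hi
  exact ⟨e, he, hg e he⟩

theorem exists_light_of_two {α : Type*} [DecidableEq α] {s : Finset α}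
    {w : α → Fin 2 → ℝ} (hw : ∀ e i, 0 ≤ w e i) (hs : 3 ≤ s.card) :
    ∃ e ∈ s, ∀ i, 2 * w e i ≤ ∑ e' ∈ s, w e' i := by
  rcases exists_light_or_majority hw (by omega : 2 ≤ s.card) with h | ⟨h, -⟩
  · exact h
  · omega

/-- In a cycle with three objectives there are two candidate edges: both are light for the third
objective, and their excesses over half the total weight in the first two are opposite. -/
theorem exists_balanced_pair {α : Type*} [DecidableEq α] {s : Finset α}
    {w : α → Fin 3 → ℝ} (hw : ∀ e i, 0 ≤ w e i) (hs : 3 ≤ s.card) {A B : ℝ} (hA : 0 ≤ A)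
    (hB : 0 ≤ B) (hwA : ∀ e ∈ s, w e 0 ≤ A) (hwB : ∀ e ∈ s, w e 1 ≤ B) :
    ∃ p ∈ s, ∃ q ∈ s, ∃ a b : ℝ, 0 ≤ a ∧ a ≤ A ∧ 0 ≤ b ∧ b ≤ B ∧
      2 * w p 0 ≤ ∑ e ∈ s, w e 0 + a ∧ 2 * w q 0 ≤ ∑ e ∈ s, w e 0 - a ∧
      2 * w p 1 ≤ ∑ e ∈ s, w e 1 - b ∧ 2 * w q 1 ≤ ∑ e ∈ s, w e 1 + b ∧
      2 * w p 2 ≤ ∑ e ∈ s, w e 2 ∧ 2 * w q 2 ≤ ∑ e ∈ s, w e 2 := by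
  by_cases hlight : ∃ e ∈ s, ∀ i, 2 * w e i ≤ ∑ e' ∈ s, w e' i
  · obtain ⟨e, he, h⟩ := hlight
    exact ⟨e, he, e, he, 0, 0, le_rfl, hA, le_rfl, hB, by simpa using h 0, by simpa using h 0,
      by simpa using h 1, by simpa using h 1, h 2, h 2⟩
  obtain ⟨hcard, hmaj⟩ := (exists_light_or_majority hw hs).resolve_left hlight
  push Not at hlight
  choose g hg using hlight
  choose f hfs hf using hmaj
  have hpair : ∀ i, ∀ a ∈ s, ∀ b ∈ s, a ≠ b → w a i + w b i ≤ ∑ e ∈ s, w e i :=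
    fun i a ha b hb hab => Finset.add_le_sum_of_mem_of_ne (fun e => hw e i) ha hb hab
  have huniq : ∀ i, ∀ e ∈ s, ∑ e' ∈ s, w e' i < 2 * w e i → e = f i := by
    intro i e he h
    by_contra hne
    have := hpair i e he (f i) (hfs i) hne
    linarith [hf i]
  have hsub : s ⊆ Finset.univ.image f := fun e he =>
    Finset.mem_image.2 ⟨g e he, Finset.mem_univ _, (huniq _ e he (hg e he)).symm⟩
  have hinj : Function.Injective f := by
    rw [← Set.injOn_univ, ← Finset.coe_univ, ← Finset.card_image_iff]
    have h1 := Finset.card_le_card hsub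
    have h2 : (Finset.univ.image f).card ≤ (Finset.univ : Finset (Fin 3)).card :=
      Finset.card_image_le
    simp only [Finset.card_univ, Fintype.card_fin] at h2 ⊢
    omega
  have h01 : f 0 ≠ f 1 := hinj.ne (by decide)
  have h02 : f 0 ≠ f 2 := hinj.ne (by decide)
  have h12 : f 1 ≠ f 2 := hinj.ne (by decide)
  have hle : ∀ i, w (f i) i ≤ ∑ e ∈ s, w e i := fun i =>
    Finset.single_le_sum (f := fun e => w e i) (fun e _ => hw e i) (hfs i)
  have p0 := hpair 0 _ (hfs 0) _ (hfs 1) h01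
  have p1 := hpair 1 _ (hfs 0) _ (hfs 1) h01
  have p2 := hpair 2 _ (hfs 0) _ (hfs 2) h02
  have p2' := hpair 2 _ (hfs 1) _ (hfs 2) h12
  exact ⟨f 0, hfs 0, f 1, hfs 1, 2 * w (f 0) 0 - ∑ e ∈ s, w e 0, 2 * w (f 1) 1 - ∑ e ∈ s, w e 1,
    by linarith [hf 0], by linarith [hle 0, hwA _ (hfs 0)], by linarith [hf 1],
    by linarith [hle 1, hwB _ (hfs 1)], by linarith, by linarith, by linarith, by linarith,
    by linarith [hf 2], by linarith [hf 2]⟩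

/-- Moving a pair of coordinates in `[-1, 1]` until one becomes `±1`, preserving the first linear
functional and not decreasing the second. -/
theorem exists_round_pair {a b c d x y : ℝ} (ha : 0 < a) (hc : 0 < c) (h : c * b ≥ a * d)
    (hx : |x| ≤ 1) (hy : |y| ≤ 1) :
    ∃ x' y' : ℝ, |x'| ≤ 1 ∧ |y'| ≤ 1 ∧ (|x'| = 1 ∨ |y'| = 1) ∧
      x' * a + y' * c = x * a + y * c ∧ x * b + y * d ≤ x' * b + y' * d := by
  rw [abs_le] at hx hy
  have key : ∀ t : ℝ, 0 ≤ t → x * b + y * d ≤ (x + t * c) * b + (y - t * a) * d := by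
    intro t ht
    nlinarith [mul_nonneg ht (sub_nonneg.2 h)]
  rcases le_total ((1 - x) / c) ((y + 1) / a) with hle | hle
  · have ht : 0 ≤ (1 - x) / c := div_nonneg (by linarith) hc.le
    have e1 : (1 - x) / c * c = 1 - x := by field_simp
    have e2 : (1 - x) / c * a ≤ y + 1 := by rwa [le_div_iff₀ ha] at hle
    have e3 := mul_nonneg ht ha.le
    refine ⟨x + (1 - x) / c * c, y - (1 - x) / c * a, ?_, ?_, Or.inl ?_, by ring, key _ ht⟩
    · rw [e1, abs_le]; constructor <;> linarith
    · rw [abs_le]; constructor <;> linarith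
    · rw [e1]; simp
  · have ht : 0 ≤ (y + 1) / a := div_nonneg (by linarith) ha.le
    have e1 : (y + 1) / a * a = y + 1 := by field_simp
    have e2 : (y + 1) / a * c ≤ 1 - x := by rwa [le_div_iff₀ hc] at hle
    have e3 := mul_nonneg ht hc.le
    refine ⟨x + (y + 1) / a * c, y - (y + 1) / a * a, ?_, ?_, Or.inr ?_, by ring, key _ ht⟩
    · rw [abs_le]; constructor <;> linarith
    · rw [e1, abs_le]; constructor <;> linarith
    · rw [e1]; simp

theorem abs_ite_sub_le_one {x : ℝ} (hx : |x| ≤ 1) : |(if 0 ≤ x then 1 else -1) - x| ≤ 1 := by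
  rw [abs_le] at hx ⊢
  split_ifs <;> constructor <;> linarith

theorem exists_sign_rounding {ι : Type*} [Fintype ι] [DecidableEq ι] {a b : ι → ℝ} {A B : ℝ}
    (hA : 0 ≤ A) (hB : 0 ≤ B)
    (ha : ∀ j, 0 ≤ a j) (haA : ∀ j, a j ≤ A) (hb : ∀ j, 0 ≤ b j) (hbB : ∀ j, b j ≤ B)
    (x : ι → ℝ) (hx : ∀ j, |x j| ≤ 1) :
    ∃ ε : ι → ℝ, (∀ j, |ε j| = 1) ∧ ∑ j, ε j * a j ≤ ∑ j, x j * a j + A ∧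
      ∑ j, x j * b j - B ≤ ∑ j, ε j * b j := by
  induction hn : (Finset.univ.filter fun j => |x j| ≠ 1).card using Nat.strong_induction_on
    generalizing x with
  | _ n ih =>
  subst hn
  have sum_update : ∀ (c y : ι → ℝ) (p : ι) (v : ℝ),
      ∑ j, Function.update y p v j * c j = ∑ j, y j * c j + (v - y p) * c p := by
    intro c y p v
    rw [← Finset.add_sum_erase _ _ (Finset.mem_univ p),
      ← Finset.add_sum_erase _ (fun j => y j * c j) (Finset.mem_univ p),
      Finset.sum_congr rfl (g := fun j => y j * c j)]
    · simp only [Function.update_self]; ring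
    · intro j hj
      rw [Function.update_of_ne (Finset.ne_of_mem_erase hj)]
  have step : ∀ y : ι → ℝ, (∀ j, |y j| ≤ 1) → (∀ j, |x j| = 1 → |y j| = 1) →
      (∃ j, |x j| ≠ 1 ∧ |y j| = 1) → ∑ j, y j * a j ≤ ∑ j, x j * a j →
      ∑ j, x j * b j ≤ ∑ j, y j * b j →
      ∃ ε : ι → ℝ, (∀ j, |ε j| = 1) ∧ ∑ j, ε j * a j ≤ ∑ j, x j * a j + A ∧
        ∑ j, x j * b j - B ≤ ∑ j, ε j * b j := by
    intro y hy hxy ⟨p, hp, hp'⟩ h1 h2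
    obtain ⟨ε, hε, h3, h4⟩ := ih _ (Finset.card_lt_card (by
      rw [Finset.ssubset_iff_of_subset]
      · exact ⟨p, by simpa using hp, by simpa using hp'⟩
      · intro j hj
        simp only [Finset.mem_filter, Finset.mem_univ, true_and] at hj ⊢
        exact fun h => hj (hxy j h))) y hy rfl
    exact ⟨ε, hε, by linarith, by linarith⟩
  have update_step : ∀ p v, |x p| ≠ 1 → |v| = 1 → (v - x p) * a p ≤ 0 → 0 ≤ (v - x p) * b p →
      ∃ ε : ι → ℝ, (∀ j, |ε j| = 1) ∧ ∑ j, ε j * a j ≤ ∑ j, x j * a j + A ∧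
        ∑ j, x j * b j - B ≤ ∑ j, ε j * b j := by
    intro p v hp hv h1 h2
    refine step (Function.update x p v) ?_ ?_ ⟨p, hp, by simpa using hv⟩ ?_ ?_
    · intro j
      by_cases hj : j = p
      · subst hj; simp [hv]
      · simpa [Function.update_of_ne hj] using hx j
    · intro j h
      have hj : j ≠ p := by rintro rfl; exact hp h
      simpa [Function.update_of_ne hj] using h
    · rw [sum_update]; linarith
    · rw [sum_update]; linarith
  by_cases h2 : ∃ p q, p ≠ q ∧ |x p| ≠ 1 ∧ |x q| ≠ 1
  · obtain ⟨p, q, hpq, hp, hq, hdet⟩ :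
        ∃ p q, p ≠ q ∧ |x p| ≠ 1 ∧ |x q| ≠ 1 ∧ a q * b p ≥ a p * b q := by
      obtain ⟨p, q, hpq, hp, hq⟩ := h2
      rcases le_total (a p * b q) (a q * b p) with h | h
      · exact ⟨p, q, hpq, hp, hq, h⟩
      · exact ⟨q, p, hpq.symm, hq, hp, h⟩
    have zero_step : ∀ r, |x r| ≠ 1 → a r = 0 →
        ∃ ε : ι → ℝ, (∀ j, |ε j| = 1) ∧ ∑ j, ε j * a j ≤ ∑ j, x j * a j + A ∧
          ∑ j, x j * b j - B ≤ ∑ j, ε j * b j := fun r hr h0 =>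
      update_step r 1 hr (by simp) (by simp [h0])
        (mul_nonneg (by linarith [(abs_le.1 (hx r)).2]) (hb r))
    rcases (ha p).eq_or_lt with h0 | hap
    · exact zero_step p hp h0.symm
    rcases (ha q).eq_or_lt with h0 | haq
    · exact zero_step q hq h0.symm
    obtain ⟨u, v, hu, hv, huv, hsa, hsb⟩ := exists_round_pair hap haq hdet (hx p) (hx q)
    have hy : ∀ c : ι → ℝ, ∑ j, Function.update (Function.update x p u) q v j * c j
        = ∑ j, x j * c j + (u * c p + v * c q - (x p * c p + x q * c q)) := by
      intro c
      rw [sum_update, sum_update, Function.update_of_ne hpq.symm]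
      ring
    refine step (Function.update (Function.update x p u) q v) ?_ ?_ ?_ ?_ ?_
    · intro j
      by_cases hjq : j = q
      · subst hjq; simpa using hv
      by_cases hjp : j = p
      · subst hjp; simpa [Function.update_of_ne hjq] using hu
      · simpa [Function.update_of_ne hjq, Function.update_of_ne hjp] using hx j
    · intro j h
      have hjq : j ≠ q := by rintro rfl; exact hq h
      have hjp : j ≠ p := by rintro rfl; exact hp h
      simpa [Function.update_of_ne hjq, Function.update_of_ne hjp] using h
    · rcases huv with h | h
      · exact ⟨p, hp, by simpa [Function.update_of_ne hpq] using h⟩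
      · exact ⟨q, hq, by simpa using h⟩
    · rw [hy]; linarith
    · rw [hy]; linarith
  by_cases h1 : ∃ p, |x p| ≠ 1
  · obtain ⟨p, hp⟩ := h1
    have habs := abs_le.1 (abs_ite_sub_le_one (hx p))
    have hv : |(if 0 ≤ x p then 1 else -1 : ℝ)| = 1 := by split_ifs <;> simp
    generalize (if 0 ≤ x p then 1 else -1 : ℝ) = v at habs hv
    refine ⟨Function.update x p v, ?_, ?_, ?_⟩
    · intro j
      by_cases hj : j = p
      · subst hj; simpa using hv
      · rw [Function.update_of_ne hj]
        by_contra h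
        exact h2 ⟨j, p, hj, h, hp⟩
    · rw [sum_update]
      nlinarith [mul_nonneg (sub_nonneg.2 habs.2) (ha p), haA p]
    · rw [sum_update]
      nlinarith [mul_nonneg (by linarith [habs.1] : 0 ≤ v - x p + 1) (hb p), hbB p]
  · push Not at h1
    exact ⟨x, h1, by linarith, by linarith⟩

theorem six_rpow_le {u w : ℝ} (hu : 0 ≤ u) (huw : u ≤ w) (hw : 0 < w) :
    (6 : ℝ) ^ u ≤ 1 + (6 ^ w - 1) * (u / w) := by
  have h1 : (1 : ℝ) ≤ 6 ^ w := Real.one_le_rpow (by norm_num) hw.le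
  have h := rpow_one_add_le_one_add_mul_self (s := (6 : ℝ) ^ w - 1) (by linarith)
    (div_nonneg hu hw.le) ((div_le_one hw).2 huw)
  rw [add_sub_cancel, ← Real.rpow_mul (by norm_num), mul_div_cancel₀ _ hw.ne'] at h
  linarith

theorem two_add_six_rpow_le {w : ℝ} (hw : 0 < w) (hw1 : w ≤ 1) :
    2 + (6 : ℝ) ^ w ≤ 3 * (8 / 3 : ℝ) ^ w := by
  have h := (Real.concaveOn_rpow hw.le hw1).2 (show (1 : ℝ) ∈ Set.Ici 0 by simp)
    (show (6 : ℝ) ∈ Set.Ici 0 by simp) (show (0 : ℝ) ≤ 2 / 3 by norm_num)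
    (show (0 : ℝ) ≤ 1 / 3 by norm_num) (by norm_num)
  simp only [smul_eq_mul, Real.one_rpow] at h
  norm_num at h
  linarith

theorem sum_six_rpow_le {α : Type*} {t : Finset α} (ht : t.card = 3) {u : α → ℝ} {W : ℝ}
    (hu : ∀ e ∈ t, 0 ≤ u e) (hu1 : ∀ e ∈ t, u e ≤ 1) (hW : ∑ e ∈ t, u e ≤ W) :
    ∑ e ∈ t, (6 : ℝ) ^ u e ≤ 3 * (8 / 3 : ℝ) ^ W := by
  have hW0 : 0 ≤ W := (Finset.sum_nonneg hu).trans hW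
  have huW : ∀ e ∈ t, u e ≤ W := fun e he => (Finset.single_le_sum hu he).trans hW
  have bound : ∀ v : ℝ, 0 < v → (∀ e ∈ t, u e ≤ v) →
      ∑ e ∈ t, (6 : ℝ) ^ u e ≤ 3 + (6 ^ v - 1) * (W / v) := by
    intro v hv huv
    have h1 : (1 : ℝ) ≤ 6 ^ v := Real.one_le_rpow (by norm_num) hv.le
    calc ∑ e ∈ t, (6 : ℝ) ^ u e ≤ ∑ e ∈ t, (1 + (6 ^ v - 1) * (u e / v)) :=
          Finset.sum_le_sum fun e he => six_rpow_le (hu e he) (huv e he) hv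
      _ = 3 + (6 ^ v - 1) * ((∑ e ∈ t, u e) / v) := by
          rw [Finset.sum_add_distrib, ← Finset.mul_sum, ← Finset.sum_div]; simp [ht]
      _ ≤ _ := by
          gcongr
  rcases hW0.eq_or_lt with rfl | hpos
  · have h0 : ∀ e ∈ t, (6 : ℝ) ^ u e = 1 := fun e he => by
      rw [le_antisymm (huW e he) (hu e he), Real.rpow_zero]
    rw [Finset.sum_congr rfl h0]
    simp [ht]
  rcases le_total W 1 with h1 | h1
  · have := bound W hpos huW
    rw [div_self hpos.ne'] at this
    linarith [two_add_six_rpow_le hpos h1]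
  · have := bound 1 one_pos hu1
    have hB := one_add_mul_self_le_rpow_one_add (s := (5 / 3 : ℝ)) (by norm_num) h1
    norm_num at this hB ⊢
    linarith

/-- Method of conditional expectations: some choice of one edge per cycle keeps the exponential
potential below its initial value. -/
theorem exists_choice_potential_le {α ι κ : Type*} [DecidableEq ι] (I : Finset κ) (J : Finset ι)
    (E : ι → Finset α) (hcard : ∀ j, 3 ≤ (E j).card) (u : α → κ → ℝ) (hu : ∀ e, ∀ i ∈ I, 0 ≤ u e i)
    (hu1 : ∀ j, ∀ e ∈ E j, ∀ i ∈ I, u e i ≤ 1) :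
    ∃ r : ι → α, (∀ j, r j ∈ E j) ∧
      ∑ i ∈ I, (6 : ℝ) ^ (∑ j ∈ J, u (r j) i) / (8 / 3 : ℝ) ^ (∑ j ∈ J, ∑ e ∈ E j, u e i)
        ≤ I.card := by
  induction J using Finset.induction_on with
  | empty =>
    have hne : ∀ j, ∃ e, e ∈ E j := fun j =>
      Finset.card_pos.1 (by have := hcard j; omega)
    choose r hr using hne
    exact ⟨r, hr, by simp⟩
  | insert p J hp ih =>
    obtain ⟨r, hr, h⟩ := ih
    obtain ⟨t, htE, ht⟩ := Finset.exists_subset_card_eq (hcard p)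
    set φ : κ → ℝ := fun i =>
      (6 : ℝ) ^ (∑ j ∈ J, u (r j) i) / (8 / 3 : ℝ) ^ (∑ j ∈ J, ∑ e ∈ E j, u e i) with hφ
    have hφ0 : ∀ i, 0 ≤ φ i := fun i => by positivity
    obtain ⟨e, he, hle⟩ : ∃ e ∈ t, ∑ i ∈ I, φ i * ((6 : ℝ) ^ u e i / (8 / 3) ^ ∑ e ∈ E p, u e i)
        ≤ ∑ i ∈ I, φ i := by
      apply Finset.exists_le_of_sum_le (Finset.card_pos.1 (by omega))
      rw [Finset.sum_comm, Finset.sum_const, ht, Finset.smul_sum]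
      refine Finset.sum_le_sum fun i hi => ?_
      rw [← Finset.mul_sum, ← Finset.sum_div, nsmul_eq_mul, mul_comm]
      refine mul_le_mul_of_nonneg_right ?_ (hφ0 i)
      rw [div_le_iff₀ (by positivity)]
      exact_mod_cast sum_six_rpow_le ht (fun e _ => hu e i hi) (fun e he => hu1 p e (htE he) i hi)
        (Finset.sum_le_sum_of_subset_of_nonneg htE fun e _ _ => hu e i hi)
    refine ⟨Function.update r p e, ?_, ?_⟩
    · intro j
      by_cases hj : j = p
      · subst hj; simpa using htE he
      · simpa [Function.update_of_ne hj] using hr j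
    · refine le_trans (le_of_eq (Finset.sum_congr rfl fun i _ => ?_)) (hle.trans h)
      have hJ : ∑ j ∈ J, u (Function.update r p e j) i = ∑ j ∈ J, u (r j) i :=
        Finset.sum_congr rfl fun j hj => by
          rw [Function.update_of_ne (by rintro rfl; exact hp hj)]
      rw [Finset.sum_insert hp, Finset.sum_insert hp, hJ, Function.update_self,
        Real.rpow_add (by norm_num), Real.rpow_add (by norm_num), hφ]
      field_simp

theorem mul_pow_le_six_pow {k : ℕ} (hk : 4 ≤ k) : (k : ℝ) * (8 / 3) ^ k * 6 ≤ 6 ^ k := by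
  induction k, hk using Nat.le_induction with
  | base => norm_num
  | succ n hn ih =>
    have hn' : (4 : ℝ) ≤ n := by exact_mod_cast hn
    have hp : (0 : ℝ) < (8 / 3) ^ n := by positivity
    rw [pow_succ, pow_succ]
    push_cast
    nlinarith [mul_le_mul_of_nonneg_right hn' hp.le]

theorem exists_removal_of_four_le {k : ℕ} (hk : 4 ≤ k) {α : Type*}
    {m : ℕ} {E : Fin m → Finset α} (hcard : ∀ j, 3 ≤ (E j).card)
    {w : α → Fin k → ℝ} (hw : ∀ e i, 0 ≤ w e i)
    (hlight : ∀ j, ∀ e ∈ E j, ∀ i, k * w e i ≤ ∑ j', ∑ e' ∈ E j', w e' i) :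
    ∃ r : Fin m → α, (∀ j, r j ∈ E j) ∧
      ∀ i, k * ∑ j, w (r j) i ≤ (k - 1) * ∑ j, ∑ e ∈ E j, w e i := by
  have hk' : (4 : ℝ) ≤ k := by exact_mod_cast hk
  set T : Fin k → ℝ := fun i => ∑ j, ∑ e ∈ E j, w e i with hT
  have hT0 : ∀ i, 0 ≤ T i := fun i =>
    Finset.sum_nonneg fun j _ => Finset.sum_nonneg fun e _ => hw e i
  set I : Finset (Fin k) := Finset.univ.filter fun i => 0 < T i with hI
  have hIpos : ∀ i ∈ I, 0 < T i := fun i hi => (Finset.mem_filter.1 hi).2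
  obtain ⟨r, hr, h⟩ := exists_choice_potential_le I Finset.univ E hcard
    (fun e i => w e i * (k / T i))
    (fun e i _ => mul_nonneg (hw e i) (div_nonneg (by positivity) (hT0 i)))
    (fun j e he i hi => by
      rw [← mul_div_assoc, div_le_one (hIpos i hi), mul_comm]
      exact hlight j e he i)
  refine ⟨r, hr, fun i => ?_⟩
  change _ ≤ (k - 1 : ℝ) * T i
  rcases (hT0 i).eq_or_lt with h0 | hpos
  · have hz : ∀ j, w (r j) i = 0 := fun j => by
      have := hlight j (r j) (hr j) i
      change _ ≤ T i at this
      nlinarith [hw (r j) i]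
    simp [hz, ← h0]
  · by_contra! hcon
    have hi : i ∈ I := Finset.mem_filter.2 ⟨Finset.mem_univ i, hpos⟩
    have h1 := (Finset.single_le_sum (f := fun i =>
      (6 : ℝ) ^ (∑ j, w (r j) i * (k / T i)) / (8 / 3 : ℝ) ^ (∑ j, ∑ e ∈ E j, w e i * (k / T i)))
      (fun i _ => by positivity) hi).trans h
    have htot : ∑ j, ∑ e ∈ E j, w e i * (k / T i) = k := by
      simp_rw [← Finset.sum_mul]
      exact mul_div_cancel₀ _ hpos.ne'
    have hcardI : (I.card : ℝ) ≤ k := by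
      exact_mod_cast (by simpa using Finset.card_le_univ I : I.card ≤ k)
    rw [htot, ← Finset.sum_mul, div_le_iff₀ (by positivity), Real.rpow_natCast] at h1
    have hlt : (k - 1 : ℝ) < (∑ j, w (r j) i) * (k / T i) := by
      rw [← mul_div_assoc, lt_div_iff₀ hpos]
      linarith
    have h2 := Real.rpow_lt_rpow_of_exponent_lt (by norm_num : (1 : ℝ) < 6) hlt
    rw [Real.rpow_sub_one (by norm_num), Real.rpow_natCast] at h2
    have h3 := mul_pow_le_six_pow hk
    have h4 : (I.card : ℝ) * (8 / 3) ^ k ≤ k * (8 / 3) ^ k := by gcongr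
    linarith

theorem exists_removal_of_two {α : Type*} [DecidableEq α]
    {m : ℕ} {E : Fin m → Finset α} (hcard : ∀ j, 3 ≤ (E j).card)
    {w : α → Fin 2 → ℝ} (hw : ∀ e i, 0 ≤ w e i) :
    ∃ r : Fin m → α, (∀ j, r j ∈ E j) ∧
      ∀ i, 2 * ∑ j, w (r j) i ≤ ∑ j, ∑ e ∈ E j, w e i := by
  choose r hr h using fun j => exists_light_of_two hw (hcard j)
  refine ⟨r, hr, fun i => ?_⟩
  rw [Finset.mul_sum]
  exact Finset.sum_le_sum fun j _ => h j i

theorem exists_removal_of_three {α : Type*} [DecidableEq α]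
    {m : ℕ} {E : Fin m → Finset α} (hcard : ∀ j, 3 ≤ (E j).card)
    {w : α → Fin 3 → ℝ} (hw : ∀ e i, 0 ≤ w e i)
    (hlight : ∀ j, ∀ e ∈ E j, ∀ i, 3 * w e i ≤ ∑ j', ∑ e' ∈ E j', w e' i) :
    ∃ r : Fin m → α, (∀ j, r j ∈ E j) ∧
      ∀ i, 3 * ∑ j, w (r j) i ≤ 2 * ∑ j, ∑ e ∈ E j, w e i := by
  set T : Fin 3 → ℝ := fun i => ∑ j, ∑ e ∈ E j, w e i with hT
  have hT0 : ∀ i, 0 ≤ T i := fun i =>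
    Finset.sum_nonneg fun j _ => Finset.sum_nonneg fun e _ => hw e i
  have hlight' : ∀ j, ∀ e ∈ E j, ∀ i, w e i ≤ T i / 3 := fun j e he i => by
    have := hlight j e he i
    change _ ≤ T i at this
    linarith
  have hA : 0 ≤ T 0 / 3 := by linarith [hT0 0]
  have hB : 0 ≤ T 1 / 3 := by linarith [hT0 1]
  choose p hp q hq a b ha haA hb hbB p0 q0 p1 q1 p2 q2 using fun j =>
    exists_balanced_pair hw (hcard j) hA hB (fun e he => hlight' j e he 0)
      (fun e he => hlight' j e he 1)
  obtain ⟨ε, hε, h0, h1⟩ := exists_sign_rounding hA hB ha haA hb hbB 0 (by simp)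
  simp only [Pi.zero_apply, zero_mul, Finset.sum_const_zero, zero_add, zero_sub] at h0 h1
  let r : Fin m → α := fun j => if ε j = 1 then p j else q j
  have hr : ∀ j, (ε j = 1 ∧ r j = p j) ∨ (ε j = -1 ∧ r j = q j) := fun j => by
    rcases eq_or_eq_neg_of_abs_eq (hε j) with h | h
    · exact Or.inl ⟨h, if_pos h⟩
    · exact Or.inr ⟨h, if_neg (by rw [h]; norm_num)⟩
  have r0 : 2 * ∑ j, w (r j) 0 ≤ T 0 + ∑ j, ε j * a j := by
    rw [Finset.mul_sum, hT, ← Finset.sum_add_distrib]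
    refine Finset.sum_le_sum fun j _ => ?_
    rcases hr j with ⟨h, h'⟩ | ⟨h, h'⟩ <;> rw [h, h'] <;> linarith [p0 j, q0 j]
  have r1 : 2 * ∑ j, w (r j) 1 ≤ T 1 - ∑ j, ε j * b j := by
    rw [Finset.mul_sum, hT, ← Finset.sum_sub_distrib]
    refine Finset.sum_le_sum fun j _ => ?_
    rcases hr j with ⟨h, h'⟩ | ⟨h, h'⟩ <;> rw [h, h'] <;> linarith [p1 j, q1 j]
  have r2 : 2 * ∑ j, w (r j) 2 ≤ T 2 := by
    rw [Finset.mul_sum, hT]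
    refine Finset.sum_le_sum fun j _ => ?_
    rcases hr j with ⟨h, h'⟩ | ⟨h, h'⟩ <;> rw [h'] <;> linarith [p2 j, q2 j]
  refine ⟨r, fun j => ?_, fun i => ?_⟩
  · rcases hr j with ⟨-, h⟩ | ⟨-, h⟩ <;> rw [h]
    exacts [hp j, hq j]
  · change _ ≤ 2 * T i
    fin_cases i
    · change 3 * ∑ j, w (r j) 0 ≤ 2 * T 0
      linarith
    · change 3 * ∑ j, w (r j) 1 ≤ 2 * T 1
      linarith
    · change 3 * ∑ j, w (r j) 2 ≤ 2 * T 2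
      linarith [hT0 2]

theorem exists_removal {k : ℕ} (hk : 2 ≤ k) {α : Type*} [DecidableEq α]
    {m : ℕ} {E : Fin m → Finset α} (hcard : ∀ j, 3 ≤ (E j).card)
    {w : α → Fin k → ℝ} (hw : ∀ e i, 0 ≤ w e i)
    (hlight : ∀ j, ∀ e ∈ E j, ∀ i, k * w e i ≤ ∑ j', ∑ e' ∈ E j', w e' i) :
    ∃ r : Fin m → α, (∀ j, r j ∈ E j) ∧
      ∀ i, k * ∑ j, w (r j) i ≤ (k - 1) * ∑ j, ∑ e ∈ E j, w e i := by
  obtain rfl | rfl | h4 : k = 2 ∨ k = 3 ∨ 4 ≤ k := by omega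
  · obtain ⟨r, hr, h⟩ := exists_removal_of_two hcard hw
    refine ⟨r, hr, fun i => ?_⟩
    have := h i
    push_cast
    linarith
  · obtain ⟨r, hr, h⟩ := exists_removal_of_three hcard hw (by exact_mod_cast hlight)
    refine ⟨r, hr, fun i => ?_⟩
    have := h i
    push_cast
    linarith
  · exact exists_removal_of_four_le h4 hcard hw hlight

/-- Theorem (α_k^u ≥ 1/k): for k ≥ 2, every undirected cycle cover (cycles have
at least 3 edges) all of whose edges have weight at most (1/k) of the total
weight (componentwise) possesses a (1/k)-decomposition. -/
theorem alpha_k_undirected_ge_one_div_k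
    (k : ℕ) (hk : 2 ≤ k) {α : Type*} [DecidableEq α]
    (m : ℕ) (E : Fin m → Finset α)
    (hdisj : ∀ i j, i ≠ j → Disjoint (E i) (E j))
    (hcard : ∀ j, 3 ≤ (E j).card)
    (w : α → Fin k → ℝ) (hw : ∀ e i, 0 ≤ w e i)
    (hlight : ∀ j, ∀ e ∈ E j, ∀ i,
      w e i ≤ (1 / (k : ℝ)) * ∑ j', ∑ e' ∈ E j', w e' i) :
    ∃ P : Fin m → Finset α,
      (∀ j, P j ⊆ E j ∧ P j ≠ E j) ∧
      ∀ i, (1 / (k : ℝ)) * (∑ j, ∑ e ∈ E j, w e i) ≤ ∑ j, ∑ e ∈ P j, w e i := by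
  have hk0 : (0 : ℝ) < k := by exact_mod_cast (by omega : 0 < k)
  obtain ⟨r, hr, h⟩ := exists_removal hk hcard hw fun j e he i => by
    have := hlight j e he i
    rwa [one_div, ← div_eq_inv_mul, le_div_iff₀ hk0, mul_comm] at this
  refine ⟨fun j => (E j).erase (r j), fun j => ⟨Finset.erase_subset _ _, fun heq => ?_⟩,
    fun i => ?_⟩
  · exact Finset.notMem_erase (r j) (E j) ((Finset.ext_iff.1 heq (r j)).2 (hr j))
  · have hsum : ∑ j, ∑ e ∈ (E j).erase (r j), w e i
        = ∑ j, ∑ e ∈ E j, w e i - ∑ j, w (r j) i := by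
      rw [← Finset.sum_sub_distrib]
      exact Finset.sum_congr rfl fun j _ => Finset.sum_erase_eq_sub (hr j)
    rw [hsum, one_div, ← div_eq_inv_mul, div_le_iff₀ hk0]
    linarith [h i]
end

section
/- For every integer k ≥ 2, every directed cycle cover C with k objectives (every cycle has at least 2 edges) such that every edge e of C satisfies w(e) ≤ (1/(k+1))·w(C) componentwise possesses a (1/(k+1))-decomposition, i.e., a collection of paths P ⊆ C with w(P) ≥ (1/(k+1))·w(C) componentwise. (In the paper's notation, α_k^d ≥ 1/(k+1).) -/
/-- A nonzero direction can be followed from a point of the cube `[-1, 1]^ι`, strictly inside in every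
coordinate where the direction is nonzero, until such a coordinate reaches the boundary. -/
lemma exists_step_to_cube_boundary {ι : Type*} [Fintype ι] (x y : ι → ℝ)
    (hx : ∀ j, |x j| ≤ 1) (hxy : ∀ j, y j ≠ 0 → |x j| < 1) (hy : y ≠ 0) :
    ∃ t : ℝ, 0 ≤ t ∧ (∀ j, |x j + t * y j| ≤ 1) ∧ ∃ j, y j ≠ 0 ∧ |x j + t * y j| = 1 := by
  classical
  let τ : ι → ℝ := fun j => if 0 < y j then (1 - x j) / y j else (-1 - x j) / y j
  have hne : (Finset.univ.filter fun j => y j ≠ 0).Nonempty := by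
    obtain ⟨j, hj⟩ := Function.ne_iff.mp hy
    exact ⟨j, by simpa using hj⟩
  obtain ⟨j₀, hj₀, hmin⟩ := Finset.exists_min_image _ τ hne
  have hyj₀ : y j₀ ≠ 0 := by simpa using hj₀
  have ht : 0 ≤ τ j₀ := by
    have h := abs_lt.mp (hxy j₀ hyj₀)
    by_cases hp : 0 < y j₀
    · simp only [τ, if_pos hp]
      exact div_nonneg (by linarith) hp.le
    · simp only [τ, if_neg hp]
      exact div_nonneg_of_nonpos (by linarith) (not_lt.mp hp)
  refine ⟨τ j₀, ht, fun j => ?_, j₀, hyj₀, ?_⟩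
  · by_cases hj : y j = 0
    · simpa [hj] using hx j
    have hle := hmin j (by simpa using hj)
    have hxj := abs_le.mp (hx j)
    rw [abs_le]
    by_cases hp : 0 < y j
    · have hτ : τ j = (1 - x j) / y j := if_pos hp
      rw [hτ, le_div_iff₀ hp] at hle
      have := mul_nonneg ht hp.le
      constructor <;> linarith
    · have hn : y j < 0 := lt_of_le_of_ne (not_lt.mp hp) hj
      have hτ : τ j = (-1 - x j) / y j := if_neg hp
      rw [hτ, le_div_iff_of_neg hn] at hle
      have := mul_nonpos_of_nonneg_of_nonpos ht hn.le
      constructor <;> linarith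
  · by_cases hp : 0 < y j₀
    · simp only [τ, if_pos hp, div_mul_cancel₀ _ hyj₀]
      simp
    · simp only [τ, if_neg hp, div_mul_cancel₀ _ hyj₀]
      simp

/-- More than `n` vectors in `ℝ^(n+1)` admit a nonzero combination with nonnegative entries. -/
lemma exists_ne_zero_combination_nonneg {ι : Type*} [Fintype ι] (n : ℕ)
    (v : ι → Fin (n + 1) → ℝ) (F : Finset ι) (hF : n < F.card) :
    ∃ y : ι → ℝ, y ≠ 0 ∧ (∀ j, y j ≠ 0 → j ∈ F) ∧ ∀ i, 0 ≤ ∑ j, y j * v j i := by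
  classical
  let f : (F → ℝ) →ₗ[ℝ] (Fin n → ℝ) := Fintype.linearCombination ℝ fun j i => v j i.castSucc
  have hker : LinearMap.ker f ≠ ⊥ := LinearMap.ker_ne_bot_of_finrank_lt (by simpa using hF)
  obtain ⟨z, hz, hz0⟩ := Submodule.exists_mem_ne_zero_of_ne_bot hker
  let y : ι → ℝ := fun j => if h : j ∈ F then z ⟨j, h⟩ else 0
  have hy0 : y ≠ 0 := by
    obtain ⟨j, hj⟩ := Function.ne_iff.mp hz0
    exact Function.ne_iff.mpr ⟨j, by simpa [y] using hj⟩
  have hyF : ∀ j, y j ≠ 0 → j ∈ F := fun j hj => by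
    by_contra h
    exact hj (dif_neg h)
  have hrow : ∀ i : Fin n, ∑ j, y j * v j i.castSucc = 0 := fun i => by
    have h := congrFun (LinearMap.mem_ker.mp hz) i
    simp only [f, Fintype.linearCombination_apply, Finset.sum_apply, Pi.smul_apply, smul_eq_mul,
      Pi.zero_apply] at h
    rw [← h, ← Finset.sum_subset (Finset.subset_univ F), ← Finset.sum_coe_sort F]
    · exact Finset.sum_congr rfl fun j _ => by simp [y]
    · intro j _ hj
      simp [y, hj]
  rcases le_total 0 (∑ j, y j * v j (Fin.last n)) with h | h
  · exact ⟨y, hy0, hyF, Fin.lastCases h fun i => (hrow i).ge⟩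
  · refine ⟨-y, neg_ne_zero.mpr hy0, fun j hj => hyF j (by simpa using hj), ?_⟩
    refine Fin.lastCases ?_ fun i => ?_
    · simpa using h
    · simp [hrow i]

/-- Some point of the cube with at most `n` coordinates in the open interval `(-1, 1)` satisfies
`n + 1` given homogeneous linear inequalities. -/
lemma exists_cube_point_card_fractional_le {ι : Type*} [Fintype ι] (n : ℕ)
    (v : ι → Fin (n + 1) → ℝ) :
    ∃ x : ι → ℝ, (∀ j, |x j| ≤ 1) ∧ (∀ i, 0 ≤ ∑ j, x j * v j i) ∧
      (Finset.univ.filter fun j => |x j| < 1).card ≤ n := by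
  classical
  suffices H : ∀ (N : ℕ) (x : ι → ℝ), (∀ j, |x j| ≤ 1) → (∀ i, 0 ≤ ∑ j, x j * v j i) →
      (Finset.univ.filter fun j => |x j| < 1).card = N → ∃ x : ι → ℝ, (∀ j, |x j| ≤ 1) ∧
      (∀ i, 0 ≤ ∑ j, x j * v j i) ∧ (Finset.univ.filter fun j => |x j| < 1).card ≤ n from
    H _ 0 (by simp) (by simp) rfl
  intro N
  induction N using Nat.strong_induction_on with
  | _ N ih =>
    intro x hx hxv hN
    rcases le_or_gt (Finset.univ.filter fun j => |x j| < 1).card n with hle | hlt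
    · exact ⟨x, hx, hxv, hle⟩
    obtain ⟨y, hy0, hyF, hyv⟩ := exists_ne_zero_combination_nonneg n v _ hlt
    have hxy : ∀ j, y j ≠ 0 → |x j| < 1 := fun j hj => by simpa using hyF j hj
    obtain ⟨t, ht, hcube, j₀, hyj₀, hj₀⟩ := exists_step_to_cube_boundary x y hx hxy hy0
    refine ih _ ?_ (fun j => x j + t * y j) hcube (fun i => ?_) rfl
    · rw [← hN]
      refine Finset.card_lt_card (Finset.ssubset_iff_of_subset ?_ |>.mpr ⟨j₀, ?_, ?_⟩)
      · intro j hj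
        by_cases h : y j = 0
        · simpa [h] using hj
        · simpa using hxy j h
      · simpa using hxy j₀ hyj₀
      · simp [hj₀]
    · have : ∑ j, (x j + t * y j) * v j i = ∑ j, x j * v j i + t * ∑ j, y j * v j i := by
        rw [Finset.mul_sum, ← Finset.sum_add_distrib]
        exact Finset.sum_congr rfl fun j _ => by ring
      rw [this]
      exact add_nonneg (hxv i) (mul_nonneg ht (hyv i))

/-- One-sided discrepancy bound: vectors in `ℝ^(n+1)` with entries bounded by `δ` can be signed so
that every coordinate of the signed sum is at least `-n * δ`. -/
lemma exists_signs_sum_ge {ι : Type*} [Fintype ι] (n : ℕ) (v : ι → Fin (n + 1) → ℝ)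
    (δ : Fin (n + 1) → ℝ) (hδ : ∀ i, 0 ≤ δ i) (hv : ∀ j i, |v j i| ≤ δ i) :
    ∃ ε : ι → ℝ, (∀ j, ε j = 1 ∨ ε j = -1) ∧ ∀ i, -(n * δ i) ≤ ∑ j, ε j * v j i := by
  classical
  obtain ⟨x, hx, hxv, hcard⟩ := exists_cube_point_card_fractional_le n v
  let ε : ι → ℝ := fun j => if 0 ≤ x j then 1 else -1
  refine ⟨ε, fun j => by by_cases h : 0 ≤ x j <;> simp [ε, h], fun i => ?_⟩
  have hdiff : ∀ j, (if |x j| < 1 then -δ i else 0) ≤ (ε j - x j) * v j i := fun j => by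
    have hxj := abs_le.mp (hx j)
    split_ifs with h
    · have h1 : |ε j - x j| ≤ 1 := by
        by_cases h0 : 0 ≤ x j
        · simp only [ε, if_pos h0, abs_le]; constructor <;> linarith
        · simp only [ε, if_neg h0, abs_le]; constructor <;> linarith
      have h2 : |(ε j - x j) * v j i| ≤ δ i := by
        rw [abs_mul]
        exact (mul_le_of_le_one_left (abs_nonneg _) h1).trans (hv j i)
      exact (abs_le.mp h2).1
    · have h1 : ε j = x j := by
        rcases (abs_eq zero_le_one).mp (le_antisymm (hx j) (not_lt.mp h)) with h | h
        · simp [ε, h]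
        · simp only [ε, h]; norm_num
      simp [h1]
  have hsum := Finset.sum_le_sum fun j (_ : j ∈ Finset.univ) => hdiff j
  simp only [← Finset.sum_filter, Finset.sum_const, nsmul_eq_mul, sub_mul,
    Finset.sum_sub_distrib] at hsum
  have hc : ((Finset.univ.filter fun j => |x j| < 1).card : ℝ) * δ i ≤ n * δ i :=
    mul_le_mul_of_nonneg_right (by exact_mod_cast hcard) (hδ i)
  linarith [hxv i]


/-- Theorem (α_k^d ≥ 1/(k+1)): for k ≥ 2, every directed cycle cover (cycles have
at least 2 edges) all of whose edges have weight at most (1/(k+1)) of the total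
weight (componentwise) possesses a (1/(k+1))-decomposition. -/
theorem alpha_k_directed_ge_one_div_k_add_one
    (k : ℕ) (hk : 2 ≤ k) {α : Type*} [DecidableEq α]
    (m : ℕ) (E : Fin m → Finset α)
    (hdisj : ∀ i j, i ≠ j → Disjoint (E i) (E j))
    (hcard : ∀ j, 2 ≤ (E j).card)
    (w : α → Fin k → ℝ) (hw : ∀ e i, 0 ≤ w e i)
    (hlight : ∀ j, ∀ e ∈ E j, ∀ i,
      w e i ≤ (1 / ((k : ℝ) + 1)) * ∑ j', ∑ e' ∈ E j', w e' i) :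
    ∃ P : Fin m → Finset α,
      (∀ j, P j ⊆ E j ∧ P j ≠ E j) ∧
      ∀ i, (1 / ((k : ℝ) + 1)) * (∑ j, ∑ e ∈ E j, w e i) ≤
        ∑ j, ∑ e ∈ P j, w e i := by
  obtain ⟨n, rfl⟩ : ∃ n, k = n + 1 := ⟨k - 1, by omega⟩
  have hpair : ∀ j, ∃ a b, a ∈ E j ∧ b ∈ E j ∧ a ≠ b := fun j =>
    Finset.one_lt_card_iff.mp (hcard j)
  choose a b ha hb hab using hpair
  set δ : Fin (n + 1) → ℝ := fun i =>
    1 / (((n + 1 : ℕ) : ℝ) + 1) * ∑ j, ∑ e ∈ E j, w e i with hδ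
  have hδT : ∀ i, ∑ j, ∑ e ∈ E j, w e i = (n + 2) * δ i := fun i => by
    simp only [hδ]
    push_cast
    field_simp
    ring
  obtain ⟨ε, hε, hsum⟩ := exists_signs_sum_ge n (fun j i => w (a j) i - w (b j) i) δ
    (fun i => mul_nonneg (by positivity)
      (Finset.sum_nonneg fun j _ => Finset.sum_nonneg fun e _ => hw e i))
    (fun j i => abs_sub_le_of_nonneg_of_le (hw _ i) (hlight j _ (ha j) i) (hw _ i)
      (hlight j _ (hb j) i))
  let r : Fin m → α := fun j => if ε j = 1 then b j else a j
  have hr : ∀ j, r j ∈ E j := fun j => by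
    by_cases h : ε j = 1
    · simpa [r, h] using hb j
    · simpa [r, h] using ha j
  refine ⟨fun j => (E j).erase (r j), fun j => ⟨Finset.erase_subset _ _,
    (Finset.erase_ssubset (hr j)).ne⟩, fun i => ?_⟩
  have hcycle : ∀ j, (∑ e ∈ E j, w e i) + ε j * (w (a j) i - w (b j) i) ≤
      2 * ∑ e ∈ (E j).erase (r j), w e i := fun j => by
    have hE := Finset.add_sum_erase (E j) (fun e => w e i) (hr j)
    have hle : ∀ e ∈ E j, e ≠ r j → w e i ≤ ∑ e ∈ (E j).erase (r j), w e i := fun e he hne =>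
      Finset.single_le_sum (f := fun e => w e i) (fun e _ => hw e i)
        (Finset.mem_erase.mpr ⟨hne, he⟩)
    rcases hε j with h | h
    · have hrj : r j = b j := by simp [r, h]
      have := hle (a j) (ha j) (hrj ▸ hab j)
      rw [hrj] at hE this ⊢
      rw [h]
      linarith
    · have hrj : r j = a j := by
        simp only [r, h]
        norm_num
      have := hle (b j) (hb j) (hrj ▸ (hab j).symm)
      rw [hrj] at hE this ⊢
      rw [h]
      linarith
  have htotal := Finset.sum_le_sum fun j (_ : j ∈ Finset.univ) => hcycle j
  rw [Finset.sum_add_distrib, ← Finset.mul_sum, hδT i] at htotal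
  change δ i ≤ _
  linarith [hsum i]
end

section
/- For every undirected cycle cover C with two objectives w = (w_1, w_2) (every cycle has at least 3 edges), there exists a collection of paths P ⊆ C with w(P) ≥ w(C)/2 componentwise. No assumption on the individual edge weights relative to w(C) is needed. -/
/-- If a finite set has more elements than there are objectives, then some element weighs at most
half of the total in every objective. -/
theorem exists_mem_forall_le_half_sum {α ι : Type*} [Fintype ι]
    (S : Finset α) (hS : Fintype.card ι < S.card) (w : α → ι → ℝ) (hw : ∀ e i, 0 ≤ w e i) :
    ∃ e ∈ S, ∀ i, w e i ≤ (∑ x ∈ S, w x i) / 2 := by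
  classical
  by_contra! h
  obtain ⟨e, he⟩ := Finset.card_pos.1 (Nat.zero_lt_of_lt hS)
  have : Nonempty ι := (h e he).nonempty
  choose! f hf using h
  obtain ⟨x, hx, y, hy, hxy, hfxy⟩ :=
    Finset.exists_ne_map_eq_of_card_lt_of_maps_to (t := Finset.univ) (f := f) hS
      (fun _ _ => Finset.mem_coe.2 (Finset.mem_univ _))
  have hxlt := hf x hx
  have hylt := hf y hy
  rw [← hfxy] at hylt
  have hpair : ∑ e ∈ {x, y}, w e (f x) ≤ ∑ e ∈ S, w e (f x) :=
    Finset.sum_le_sum_of_subset_of_nonneg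
      (Finset.insert_subset hx (Finset.singleton_subset_iff.2 hy)) fun e _ _ => hw e _
  rw [Finset.sum_pair hxy] at hpair
  linarith


/-- Lemma: every undirected cycle cover with two objectives possesses a
collection of paths of weight at least half the total weight, componentwise,
with no assumption on individual edge weights. -/
theorem undirected_two_objectives_half_decomposition
    {α : Type*} [DecidableEq α]
    (m : ℕ) (E : Fin m → Finset α)
    (hdisj : ∀ i j, i ≠ j → Disjoint (E i) (E j))
    (hcard : ∀ j, 3 ≤ (E j).card)
    (w : α → Fin 2 → ℝ) (hw : ∀ e i, 0 ≤ w e i) :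
    ∃ P : Fin m → Finset α,
      (∀ j, P j ⊆ E j ∧ P j ≠ E j) ∧
      ∀ i, (∑ j, ∑ e ∈ E j, w e i) / 2 ≤ ∑ j, ∑ e ∈ P j, w e i := by
  choose e he hle using fun j =>
    exists_mem_forall_le_half_sum (E j) (by simpa using Nat.lt_of_succ_le (hcard j)) w hw
  refine ⟨fun j => (E j).erase (e j),
    fun j => ⟨Finset.erase_subset _ _, (Finset.erase_ssubset (he j)).ne⟩, fun i => ?_⟩
  rw [Finset.sum_div]
  refine Finset.sum_le_sum fun j _ => ?_
  have hsum := Finset.add_sum_erase (E j) (fun x => w x i) (he j)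
  have hhalf := hle j i
  linarith
end

section
/- There exist real constants c > 0 and d > 0 such that for every integer k ≥ 2 the following holds with α = 1/(c·ln k + d): every directed cycle cover C with k objectives (every cycle has at least 2 edges) satisfying w(e) ≤ α·w(C) componentwise for every edge e possesses an α-decomposition. (In the paper's notation, α_k^u, α_k^d ∈ Ω(1/log k).) -/
universe u

open Finset in
/-- First-moment method for uniform random bits: some choice of the bits does at least as well as
the average, which factorises over the independent coordinates. -/
theorem exists_sum_prod_le_of_average_le {ι κ : Type*} [Fintype κ]
    (S : Finset ι) (g : ι → κ → Bool → ℝ) (h : ι → κ → ℝ)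
    (hg : ∀ i ∈ S, ∀ j b, 0 ≤ g i j b)
    (hgh : ∀ i ∈ S, ∀ j, g i j true + g i j false ≤ 2 * h i j) :
    ∃ s : κ → Bool, ∑ i ∈ S, ∏ j, g i j (s j) ≤ ∑ i ∈ S, ∏ j, h i j := by
  classical
  by_contra! hlt
  have hsum := sum_lt_sum_of_nonempty (univ_nonempty (α := κ → Bool)) fun s _ => hlt s
  have hswap : ∑ s : κ → Bool, ∑ i ∈ S, ∏ j, g i j (s j) =
      ∑ i ∈ S, ∏ j, (g i j true + g i j false) := by
    rw [sum_comm]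
    refine sum_congr rfl fun i _ => ?_
    rw [← Fintype.piFinset_univ, ← prod_univ_sum]
    simp
  have hle : ∑ i ∈ S, ∏ j, (g i j true + g i j false) ≤ ∑ i ∈ S, ∏ j, (2 * h i j) :=
    sum_le_sum fun i hi => prod_le_prod
      (fun j _ => add_nonneg (hg i hi j _) (hg i hi j _)) fun j _ => hgh i hi j
  rw [hswap] at hsum
  simp only [prod_mul_distrib, prod_const, ← mul_sum, sum_const, card_univ, Fintype.card_fun,
    Fintype.card_bool, nsmul_eq_mul] at hsum hle
  push_cast at hsum
  exact hsum.not_ge hle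

theorem Real.exp_neg_le_one_sub_half {x : ℝ} (h0 : 0 ≤ x) (h1 : x ≤ 1) :
    Real.exp (-x) ≤ 1 - x / 2 := by
  rw [Real.exp_neg, inv_le_iff_one_le_mul₀ (Real.exp_pos x)]
  nlinarith [Real.add_one_le_exp x]

theorem Real.exp_neg_add_exp_neg_le {t x y : ℝ} (ht : x + y ≤ t)
    (hx0 : 0 ≤ x) (hx1 : x ≤ 1) (hy0 : 0 ≤ y) (hy1 : y ≤ 1) :
    Real.exp (-(t - x)) + Real.exp (-(t - y)) ≤ 2 * Real.exp (-(t / 4)) := by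
  have hxy : Real.exp (-x) + Real.exp (-y) ≤ 2 * Real.exp (-((x + y) / 4)) := by
    linarith [exp_neg_le_one_sub_half hx0 hx1, exp_neg_le_one_sub_half hy0 hy1,
      Real.add_one_le_exp (-((x + y) / 4))]
  have hrest : Real.exp (-(t - x - y)) ≤ Real.exp (-((t - x - y) / 4)) :=
    Real.exp_le_exp.2 (by linarith)
  calc Real.exp (-(t - x)) + Real.exp (-(t - y))
      = Real.exp (-(t - x - y)) * (Real.exp (-x) + Real.exp (-y)) := by
        rw [mul_add, ← Real.exp_add, ← Real.exp_add, add_comm]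
        congr 2 <;> ring
    _ ≤ Real.exp (-((t - x - y) / 4)) * (2 * Real.exp (-((x + y) / 4))) := by gcongr
    _ = 2 * Real.exp (-(t / 4)) := by
        rw [mul_left_comm, ← Real.exp_add]
        ring_nf

/-- Lemma: there are constants c, d > 0 such that, with α = 1/(c·ln k + d),
every directed cycle cover with k ≥ 2 objectives (cycles have at least 2 edges)
consisting solely of light-weight edges possesses an α-decomposition
(α_k^d ∈ Ω(1/log k)). -/
theorem directed_decomposition_Omega_one_div_log :
    ∃ c : ℝ, 0 < c ∧ ∃ d : ℝ, 0 < d ∧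
      ∀ (k : ℕ), 2 ≤ k →
        ∀ {α : Type u} [DecidableEq α] (m : ℕ) (E : Fin m → Finset α)
          (w : α → Fin k → ℝ),
          (∀ i j, i ≠ j → Disjoint (E i) (E j)) →
          (∀ j, 2 ≤ (E j).card) →
          (∀ e i, 0 ≤ w e i) →
          (∀ j, ∀ e ∈ E j, ∀ i,
            w e i ≤ (1 / (c * Real.log k + d)) * ∑ j', ∑ e' ∈ E j', w e' i) →
          ∃ P : Fin m → Finset α,
            (∀ j, P j ⊆ E j ∧ P j ≠ E j) ∧
            ∀ i, (1 / (c * Real.log k + d)) * (∑ j, ∑ e ∈ E j, w e i) ≤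
              ∑ j, ∑ e ∈ P j, w e i := by
  refine ⟨4, by norm_num, 4, by norm_num, ?_⟩
  intro k hk α _ m E w _ hcard hw hlight
  have hlog : 0 ≤ Real.log k := Real.log_natCast_nonneg k
  set β : ℝ := 1 / (4 * Real.log k + 4) with hβ
  have hβ0 : 0 < β := by positivity
  set W : Fin k → ℝ := fun i => ∑ j, ∑ e ∈ E j, w e i
  have hpair : ∀ j, ∃ r : Bool → α, (∀ b, r b ∈ E j) ∧ r true ≠ r false := fun j => by
    obtain ⟨a, ha, b, hb, hab⟩ := Finset.one_lt_card.1 (hcard j)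
    exact ⟨fun c => if c then a else b, by simp [ha, hb], by simpa using hab⟩
  choose r hrE hrne using hpair
  obtain ⟨s, hs⟩ := exists_sum_prod_le_of_average_le (Finset.univ.filter fun i => 0 < W i)
    (fun i j b => Real.exp (-((∑ e ∈ (E j).erase (r j b), w e i) / (β * W i))))
    (fun i j => Real.exp (-((∑ e ∈ E j, w e i) / (β * W i) / 4)))
    (fun _ _ _ _ => (Real.exp_pos _).le) (by
      intro i hi j
      have hT : 0 < β * W i := mul_pos hβ0 (Finset.mem_filter.1 hi).2
      have hr0 (b : Bool) : 0 ≤ w (r j b) i / (β * W i) := div_nonneg (hw _ _) hT.le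
      have hr1 (b : Bool) : w (r j b) i / (β * W i) ≤ 1 :=
        (div_le_one hT).2 (hlight j _ (hrE j b) i)
      simp only [Finset.sum_erase_eq_sub (hrE j _), sub_div]
      refine Real.exp_neg_add_exp_neg_le ?_ (hr0 _) (hr1 _) (hr0 _) (hr1 _)
      rw [← add_div, ← Finset.sum_pair (f := fun e => w e i) (hrne j)]
      refine div_le_div_of_nonneg_right (Finset.sum_le_sum_of_subset_of_nonneg ?_
        fun e _ _ => hw e i) hT.le
      simp [Finset.insert_subset_iff, hrE])
  refine ⟨fun j => (E j).erase (r j (s j)), fun j =>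
    ⟨Finset.erase_subset _ _, (Finset.erase_ssubset (hrE j _)).ne⟩, fun i => ?_⟩
  change β * W i ≤ _
  have hWi : 0 ≤ W i := Finset.sum_nonneg fun j _ => Finset.sum_nonneg fun e _ => hw e i
  rcases hWi.eq_or_lt with hi | hi
  · rw [← hi, mul_zero]
    exact Finset.sum_nonneg fun j _ => Finset.sum_nonneg fun e _ => hw e i
  have hT : 0 < β * W i := mul_pos hβ0 hi
  simp only [← Real.exp_sum, Finset.sum_neg_distrib, ← Finset.sum_div] at hs
  have hbound : ∑ i with 0 < W i, Real.exp (-(W i / (β * W i) / 4)) ≤ Real.exp (-1) := by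
    calc ∑ i with 0 < W i, Real.exp (-(W i / (β * W i) / 4))
        = ∑ i with 0 < W i, Real.exp (-1) / k := by
          refine Finset.sum_congr rfl fun i hi => ?_
          have hWi : W i ≠ 0 := (Finset.mem_filter.1 hi).2.ne'
          have hexp : -(W i / (β * W i) / 4) = -1 - Real.log k := by
            rw [div_mul_cancel_right₀ hWi, hβ, one_div, inv_inv]
            ring
          rw [hexp, Real.exp_sub, Real.exp_log (by positivity)]
      _ ≤ ∑ _i : Fin k, Real.exp (-1) / k :=
          Finset.sum_le_sum_of_subset_of_nonneg (Finset.filter_subset _ _)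
            fun _ _ _ => by positivity
      _ = Real.exp (-1) := by
          simp only [Finset.sum_const, Finset.card_univ, Fintype.card_fin, nsmul_eq_mul]
          field_simp
  have hsingle := ((Finset.single_le_sum (fun _ _ => (Real.exp_pos _).le)
    (Finset.mem_filter.2 ⟨Finset.mem_univ i, hi⟩)).trans hs).trans hbound
  rw [Real.exp_le_exp, neg_le_neg_iff, one_le_div hT] at hsingle
  exact hsingle
end

section
/- For every real α > 1/2 there exists an undirected cycle cover C with 2 objectives (every cycle has at least 3 edges) such that w(e) ≤ α·w(C) componentwise for every edge e of C, but C possesses no α-decomposition. A witness is a single cycle of 3 edges whose edge weight vectors are (1,0), (0,1), and (1,1). (In the paper's notation, α_2^u ≤ 1/2.) -/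
/-- α_2^u ≤ 1/2: for every α > 1/2 there is an undirected cycle cover with two
objectives, all of whose edges are α-light, that has no α-decomposition. The
witness is a single cycle of 3 edges with weight vectors (1,0), (0,1), (1,1). -/
theorem alpha_two_undirected_le_half (a : ℝ) (ha : 1 / 2 < a) :
    ∃ (E : Fin 1 → Finset ℕ) (w : ℕ → Fin 2 → ℝ),
      (∃ e₁ e₂ e₃ : ℕ, e₁ ≠ e₂ ∧ e₁ ≠ e₃ ∧ e₂ ≠ e₃ ∧ E 0 = {e₁, e₂, e₃} ∧
        w e₁ = ![1, 0] ∧ w e₂ = ![0, 1] ∧ w e₃ = ![1, 1]) ∧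
      (∀ i j, i ≠ j → Disjoint (E i) (E j)) ∧
      (∀ j, 3 ≤ (E j).card) ∧
      (∀ e i, 0 ≤ w e i) ∧
      (∀ j, ∀ e ∈ E j, ∀ i, w e i ≤ a * ∑ j', ∑ e' ∈ E j', w e' i) ∧
      ¬ ∃ P : Fin 1 → Finset ℕ,
          (∀ j, P j ⊆ E j ∧ P j ≠ E j) ∧
          ∀ i, a * (∑ j, ∑ e ∈ E j, w e i) ≤ ∑ j, ∑ e ∈ P j, w e i := by
  let w : ℕ → Fin 2 → ℝ := fun e =>
    if e = 0 then ![1, 0] else if e = 1 then ![0, 1] else ![1, 1]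
  have w_nonneg : ∀ e i, 0 ≤ w e i := by
    intro e i
    fin_cases i <;> simp only [w] <;> split_ifs <;> simp
  have w_le_one : ∀ e i, w e i ≤ 1 := by
    intro e i
    fin_cases i <;> simp only [w] <;> split_ifs <;> simp
  have sum_w : ∀ i, ∑ e ∈ ({0, 1, 2} : Finset ℕ), w e i = 2 := by
    intro i
    fin_cases i <;> norm_num [w]
  have exists_w_eq_one : ∀ e, ∃ i, w e i = 1 := by
    intro e
    by_cases he : e = 1
    · exact ⟨1, by simp [w, he]⟩
    · exact ⟨0, by simp only [w, if_neg he]; split_ifs <;> simp⟩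
  refine ⟨fun _ => {0, 1, 2}, w,
    ⟨0, 1, 2, by decide, by decide, by decide, rfl, by simp [w], by simp [w], by simp [w]⟩,
    fun i j hij => absurd (Subsingleton.elim i j) hij, fun _ => by simp, w_nonneg, ?_, ?_⟩
  · intro _ e _ i
    rw [Fin.sum_univ_one, sum_w]
    linarith [w_le_one e i]
  · rintro ⟨P, hP, hw⟩
    obtain ⟨hsub, hne⟩ := hP 0
    obtain ⟨e, he, heP⟩ := Finset.exists_of_ssubset (hsub.ssubset_of_ne hne)
    obtain ⟨i, hi⟩ := exists_w_eq_one e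
    have hwi := hw i
    rw [Fin.sum_univ_one, Fin.sum_univ_one, sum_w] at hwi
    have hle : ∑ x ∈ insert e (P 0), w x i ≤ 2 := by
      rw [← sum_w i]
      exact Finset.sum_le_sum_of_subset_of_nonneg (Finset.insert_subset he hsub)
        fun x _ _ => w_nonneg x i
    rw [Finset.sum_insert heP, hi] at hle
    linarith
end

section
/- For every real α > 1/3 there exists a directed cycle cover C with 2 objectives (every cycle has at least 2 edges) such that w(e) ≤ α·w(C) componentwise for every edge e of C, but C possesses no α-decomposition. A witness consists of three cycles of 2 edges each, where each cycle has one edge of weight vector (1,0) and one edge of weight vector (0,1). (In the paper's notation, α_2^d ≤ 1/3.) -/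
/-- A proper subset of a pair is empty or a singleton. -/
theorem Finset.eq_empty_or_singleton_of_subset_pair_of_ne {α : Type*} [DecidableEq α]
    {S : Finset α} {x y : α} (h : S ⊆ {x, y}) (hne : S ≠ {x, y}) :
    S = ∅ ∨ S = {x} ∨ S = {y} := by
  have h' : (S : Set α) ⊆ {x, y} := by
    simpa using Finset.coe_subset.mpr h
  rcases Set.subset_pair_iff_eq.mp h' with h | h | h | h
  · exact Or.inl (by exact_mod_cast h)
  · exact Or.inr (Or.inl (by exact_mod_cast h))
  · exact Or.inr (Or.inr (by exact_mod_cast h))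
  · exact absurd (by exact_mod_cast h) hne

/-- α_2^d ≤ 1/3: for every α > 1/3 there is a directed cycle cover with two
objectives, all of whose edges are α-light, that has no α-decomposition. The
witness consists of three cycles of 2 edges each, each cycle having one edge of
weight (1,0) and one edge of weight (0,1). -/
theorem alpha_two_directed_le_third (a : ℝ) (ha : 1 / 3 < a) :
    ∃ (E : Fin 3 → Finset ℕ) (w : ℕ → Fin 2 → ℝ) (e f : Fin 3 → ℕ),
      (∀ j, E j = {e j, f j} ∧ e j ≠ f j ∧
        w (e j) = ![1, 0] ∧ w (f j) = ![0, 1]) ∧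
      (∀ i j, i ≠ j → Disjoint (E i) (E j)) ∧
      (∀ x i, 0 ≤ w x i) ∧
      (∀ j, ∀ x ∈ E j, ∀ i, w x i ≤ a * ∑ j', ∑ e' ∈ E j', w e' i) ∧
      ¬ ∃ P : Fin 3 → Finset ℕ,
          (∀ j, P j ⊆ E j ∧ P j ≠ E j) ∧
          ∀ i, a * (∑ j, ∑ x ∈ E j, w x i) ≤ ∑ j, ∑ x ∈ P j, w x i := by
  have hw_even (n : ℕ) : (if Even (2 * n) then ![1, 0] else ![0, 1] : Fin 2 → ℝ) = ![1, 0] :=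
    if_pos (even_two_mul n)
  have hw_odd (n : ℕ) : (if Even (2 * n + 1) then ![1, 0] else ![0, 1] : Fin 2 → ℝ) = ![0, 1] :=
    if_neg (by simp)
  have hne (n : ℕ) : 2 * n ≠ 2 * n + 1 := by omega
  have hnonneg (x : ℕ) (i : Fin 2) : 0 ≤ (if Even x then ![1, 0] else ![0, 1] : Fin 2 → ℝ) i := by
    split_ifs <;> fin_cases i <;> simp
  have htotal (i : Fin 2) : ∑ j : Fin 3, ∑ x ∈ ({2 * (j : ℕ), 2 * (j : ℕ) + 1} : Finset ℕ),
      (if Even x then ![1, 0] else ![0, 1] : Fin 2 → ℝ) i = 3 := by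
    simp only [Finset.sum_pair (hne _), hw_even, hw_odd]
    fin_cases i <;> simp
  refine ⟨fun j => {2 * (j : ℕ), 2 * (j : ℕ) + 1},
    fun x => if Even x then ![1, 0] else ![0, 1],
    fun j => 2 * j, fun j => 2 * j + 1,
    fun j => ⟨rfl, hne _, hw_even _, hw_odd _⟩, by decide, hnonneg, ?_, ?_⟩
  · intro j x _ i
    rw [htotal]
    have hle : (if Even x then ![1, 0] else ![0, 1] : Fin 2 → ℝ) i ≤ 1 := by
      split_ifs <;> fin_cases i <;> simp
    linarith
  · rintro ⟨P, hP, hsum⟩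
    simp only [htotal] at hsum
    have hcases (j : Fin 3) :=
      Finset.eq_empty_or_singleton_of_subset_pair_of_ne (hP j).1 (hP j).2
    have h0 := hsum 0
    have h1 := hsum 1
    rw [Fin.sum_univ_three] at h0 h1
    rcases hcases 0 with h | h | h <;> rcases hcases 1 with h' | h' | h' <;>
      rcases hcases 2 with h'' | h'' | h'' <;>
      simp only [h, h', h'', Finset.sum_empty, Finset.sum_singleton, hw_even, hw_odd,
        Matrix.cons_val_zero, Matrix.cons_val_one] at h0 h1 <;>
      linarith
end

section
/- Let δ be a real with δ < 1, let b_1, …, b_m be nonnegative reals, and for S ⊆ {1,…,m} write w(S) = ∑_{j ∈ S} b_j. Let C_1, …, C_z ⊆ {1,…,m} be pairwise disjoint sets with 1−δ ≤ w(C_ℓ) < 2−δ for every ℓ. Define I ∼ J for I, J ⊆ {1,…,m} if and only if J can be obtained from I by taking successive symmetric differences with some of the sets C_1, …, C_z. Then for every I ⊆ {1,…,m}, the equivalence class [I] = {J ⊆ {1,…,m} : J ∼ I} contains at most two sets J with w(J) < 1−δ. -/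
open Finset in
/-- A union of pairwise disjoint sets over `S ∆ T` is contained in the symmetric difference of the
translates of `I` by the unions over `S` and `T`. -/
theorem Finset.biUnion_symmDiff_subset {ι α : Type*} [DecidableEq ι] [DecidableEq α]
    {C : ι → Finset α} (hdisj : ∀ i j, i ≠ j → Disjoint (C i) (C j))
    (I : Finset α) (S T : Finset ι) :
    (symmDiff S T).biUnion C ⊆ symmDiff (symmDiff I (S.biUnion C)) (symmDiff I (T.biUnion C)) := by
  have hmem : ∀ {x i} (R : Finset ι), x ∈ C i → (x ∈ R.biUnion C ↔ i ∈ R) := by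
    intro x i R hx
    rw [mem_biUnion]
    refine ⟨fun ⟨j, hj, hxj⟩ => ?_, fun hi => ⟨i, hi, hx⟩⟩
    by_contra hi
    exact disjoint_left.mp (hdisj i j (by rintro rfl; exact hi hj)) hx hxj
  intro x hx
  obtain ⟨i, hi, hxi⟩ := mem_biUnion.mp hx
  simp only [mem_symmDiff, hmem S hxi, hmem T hxi] at hi ⊢
  tauto

open Finset in
/-- Two sets of weight less than `s` whose symmetric difference contains the union over `D` of
pairwise disjoint sets of weight at least `s` force `D` to have at most one element. -/
theorem Finset.card_le_one_of_biUnion_subset_symmDiff {ι α : Type*} [DecidableEq α]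
    {b : α → ℝ} (hb : ∀ j, 0 ≤ b j) {C : ι → Finset α}
    (hdisj : ∀ i j, i ≠ j → Disjoint (C i) (C j)) {s : ℝ} (hs : 0 < s)
    (hC : ∀ i, s ≤ ∑ j ∈ C i, b j) {J K : Finset α}
    (hJ : ∑ j ∈ J, b j < s) (hK : ∑ j ∈ K, b j < s) {D : Finset ι}
    (hD : D.biUnion C ⊆ symmDiff J K) : #D ≤ 1 := by
  have hlower : #D * s ≤ ∑ j ∈ D.biUnion C, b j := by
    rw [sum_biUnion fun i _ j _ hij => hdisj i j hij, ← nsmul_eq_mul]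
    exact card_nsmul_le_sum _ _ _ fun i _ => hC i
  have hupper : ∑ j ∈ D.biUnion C, b j ≤ ∑ j ∈ J ∪ K, b j :=
    sum_le_sum_of_subset_of_nonneg (hD.trans symmDiff_le_sup) fun j _ _ => hb j
  have hunion := sum_union_inter (s₁ := J) (s₂ := K) (f := b)
  have hinter : 0 ≤ ∑ j ∈ J ∩ K, b j := sum_nonneg fun j _ => hb j
  have hlt : (#D : ℝ) < 2 := by
    by_contra! h
    nlinarith
  exact Nat.lt_succ_iff.mp (by exact_mod_cast hlt)

open Finset in
/-- Three finite sets pairwise differing in at most one element are not all distinct. -/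
theorem Finset.eq_or_eq_or_eq_of_card_symmDiff_le_one {ι : Type*} [DecidableEq ι]
    {R S T : Finset ι} (hRS : #(symmDiff R S) ≤ 1) (hST : #(symmDiff S T) ≤ 1)
    (hRT : #(symmDiff R T) ≤ 1) : R = S ∨ S = T ∨ R = T := by
  by_contra! h
  have exists_eq : ∀ {A B : Finset ι}, A ≠ B → #(symmDiff A B) ≤ 1 → ∃ x, symmDiff A B = {x} :=
    fun hne hle => card_eq_one.mp <| le_antisymm hle <|
      card_pos.mpr <| nonempty_iff_ne_empty.mpr fun h0 => hne (symmDiff_eq_bot.mp h0)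
  obtain ⟨x, hx⟩ := exists_eq h.1 hRS
  obtain ⟨y, hy⟩ := exists_eq h.2.1 hST
  have hxy : symmDiff R T = symmDiff {x} {y} := by
    rw [← hx, ← hy, symmDiff_assoc, symmDiff_symmDiff_cancel_left]
  by_cases hne : x = y
  · subst hne
    exact h.2.2 (symmDiff_eq_bot.mp (hxy.trans (symmDiff_self _)))
  · have hxmem : x ∈ symmDiff R T := by simp [hxy, mem_symmDiff, hne]
    have hymem : y ∈ symmDiff R T := by simp [hxy, mem_symmDiff, Ne.symm hne]
    exact hne (card_le_one.mp hRT x hxmem y hymem)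


/-- Lemma: given pairwise disjoint sets C_1,…,C_z of weight in [1−δ, 2−δ), every
equivalence class of the relation "differs by symmetric differences with some of
the C_ℓ" contains at most two sets of weight less than 1−δ. -/
theorem at_most_two_light_sets_per_class
    (δ : ℝ) (hδ : δ < 1) (m : ℕ) (b : Fin m → ℝ) (hb : ∀ j, 0 ≤ b j)
    (z : ℕ) (C : Fin z → Finset (Fin m))
    (hdisj : ∀ i j, i ≠ j → Disjoint (C i) (C j))
    (hC : ∀ ℓ, 1 - δ ≤ ∑ j ∈ C ℓ, b j ∧ ∑ j ∈ C ℓ, b j < 2 - δ)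
    (I : Finset (Fin m)) :
    {J : Finset (Fin m) |
        (∃ T : Finset (Fin z), J = symmDiff I (T.biUnion C)) ∧
        ∑ j ∈ J, b j < 1 - δ}.ncard ≤ 2 := by
  by_contra! h
  obtain ⟨_, ⟨⟨R, rfl⟩, hR⟩, _, ⟨⟨S, rfl⟩, hS⟩, _, ⟨⟨T, rfl⟩, hT⟩, hRS, hRT, hST⟩ :=
    (Set.two_lt_ncard (Set.toFinite _)).mp h
  have hclose : ∀ A B : Finset (Fin z), ∑ j ∈ symmDiff I (A.biUnion C), b j < 1 - δ →
      ∑ j ∈ symmDiff I (B.biUnion C), b j < 1 - δ → (symmDiff A B).card ≤ 1 :=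
    fun A B hA hB => Finset.card_le_one_of_biUnion_subset_symmDiff hb hdisj (sub_pos.mpr hδ)
      (fun ℓ => (hC ℓ).1) hA hB (Finset.biUnion_symmDiff_subset hdisj I A B)
  rcases Finset.eq_or_eq_or_eq_of_card_symmDiff_le_one (hclose R S hR hS) (hclose S T hS hT)
    (hclose R T hR hT) with rfl | rfl | rfl
  · exact hRS rfl
  · exact hST rfl
  · exact hRT rfl
end

section
/- Let k ≥ 2 be an integer, let δ ∈ [0,1), and let b_1, …, b_m ∈ [0,1] be reals with ∑_{j=1}^m b_j = k+1−2δ. Then the number of subsets I ⊆ {1,…,m} with ∑_{j ∈ I} b_j < 1−δ is strictly less than 2^m / k; equivalently, if I is chosen uniformly at random among all subsets of {1,…,m}, then Pr(∑_{j ∈ I} b_j < 1−δ) < 1/k. -/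
open Finset in
theorem sum_powerset_sub_two_mul_sum_sq {ι : Type*} (s : Finset ι) (b : ι → ℝ) :
    ∑ I ∈ s.powerset, (∑ j ∈ s, b j - 2 * ∑ j ∈ I, b j) ^ 2 = 2 ^ #s * ∑ j ∈ s, b j ^ 2 := by
  classical
  induction s using Finset.induction_on with
  | empty => simp
  | insert a s ha ih =>
    have key : ∑ I ∈ (insert a s).powerset,
        (∑ j ∈ insert a s, b j - 2 * ∑ j ∈ I, b j) ^ 2 =
        ∑ I ∈ s.powerset, (2 * (∑ j ∈ s, b j - 2 * ∑ j ∈ I, b j) ^ 2 + 2 * b a ^ 2) := by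
      rw [sum_powerset_insert ha, ← sum_add_distrib]
      refine sum_congr rfl fun I hI => ?_
      rw [sum_insert ha, sum_insert fun h => ha (mem_powerset.1 hI h)]
      ring
    rw [key, sum_add_distrib, ← mul_sum, ih, sum_const, card_powerset, card_insert_of_notMem ha,
      sum_insert ha, nsmul_eq_mul]
    push_cast
    ring

open Finset in
theorem sum_powerset_sub_two_mul_sum_pow_four {ι : Type*} (s : Finset ι) (b : ι → ℝ) :
    ∑ I ∈ s.powerset, (∑ j ∈ s, b j - 2 * ∑ j ∈ I, b j) ^ 4 =
      2 ^ #s * (3 * (∑ j ∈ s, b j ^ 2) ^ 2 - 2 * ∑ j ∈ s, b j ^ 4) := by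
  classical
  induction s using Finset.induction_on with
  | empty => simp
  | insert a s ha ih =>
    have key : ∑ I ∈ (insert a s).powerset,
        (∑ j ∈ insert a s, b j - 2 * ∑ j ∈ I, b j) ^ 4 =
        ∑ I ∈ s.powerset, (2 * (∑ j ∈ s, b j - 2 * ∑ j ∈ I, b j) ^ 4 +
          12 * b a ^ 2 * (∑ j ∈ s, b j - 2 * ∑ j ∈ I, b j) ^ 2 + 2 * b a ^ 4) := by
      rw [sum_powerset_insert ha, ← sum_add_distrib]
      refine sum_congr rfl fun I hI => ?_
      rw [sum_insert ha, sum_insert fun h => ha (mem_powerset.1 hI h)]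
      ring
    rw [key, sum_add_distrib, sum_add_distrib, ← mul_sum, ← mul_sum, ih,
      sum_powerset_sub_two_mul_sum_sq, sum_const, card_powerset, card_insert_of_notMem ha,
      sum_insert ha, sum_insert ha, nsmul_eq_mul]
    push_cast
    ring

open Finset in
/-- Complementation matches the subsets of weight less than `c` with those of weight greater than
`∑ j, b j - c`; the remaining subsets have weight in between. -/
theorem two_mul_card_light_add_card_middle {ι : Type*} [Fintype ι] (b : ι → ℝ) {c : ℝ}
    (hc : 2 * c ≤ ∑ j, b j) :
    2 * #{I : Finset ι | ∑ j ∈ I, b j < c} +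
      #{I : Finset ι | c ≤ ∑ j ∈ I, b j ∧ ∑ j ∈ I, b j ≤ ∑ j, b j - c} =
      2 ^ Fintype.card ι := by
  classical
  have heavy : #{I : Finset ι | ∑ j ∈ I, b j < c} =
      #{I : Finset ι | ∑ j, b j - c < ∑ j ∈ I, b j} := by
    refine card_bij (fun I _ => Iᶜ) (fun I hI => ?_) (fun _ _ _ _ h => compl_injective h)
      (fun I hI => ⟨Iᶜ, ?_, compl_compl I⟩) <;>
    · simp only [mem_filter, mem_univ, true_and] at hI ⊢
      linarith [sum_add_sum_compl I b]
  rw [two_mul]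
  nth_rewrite 2 [heavy]
  rw [← Fintype.card_finset, ← card_univ, ← card_union_of_disjoint, ← card_union_of_disjoint]
  · congr 1
    ext I
    simp only [mem_union, mem_filter, mem_univ, true_and, iff_true]
    grind
  · simp only [disjoint_left, mem_union, mem_filter, mem_univ, true_and]
    grind
  · simp only [disjoint_left, mem_filter, mem_univ, true_and]
    intro I h₁ h₂
    linarith

open Finset in
theorem exists_sum_mem_Ico {ι : Type*} [Fintype ι] (b : ι → ℝ) (hb : ∀ j, b j ≤ 1) {c : ℝ}
    (hc : 0 < c) (hsum : c ≤ ∑ j, b j) :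
    ∃ I : Finset ι, ∑ j ∈ I, b j ∈ Set.Ico c (c + 1) := by
  classical
  obtain ⟨I, hI, hmin⟩ := exists_min_image ({I : Finset ι | c ≤ ∑ j ∈ I, b j} : Finset _)
    card ⟨univ, by simpa using hsum⟩
  simp only [mem_filter, mem_univ, true_and] at hI hmin
  refine ⟨I, hI, ?_⟩
  have hne : I.Nonempty := by
    rw [nonempty_iff_ne_empty]
    rintro rfl
    simp only [sum_empty] at hI
    linarith
  obtain ⟨a, ha⟩ := hne
  have hlt : ∑ j ∈ I.erase a, b j < c := by
    by_contra! h
    exact absurd (hmin _ h) (card_erase_lt_of_mem ha).not_ge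
  linarith [add_sum_erase I b ha, hb a]

open Finset in
/-- The quartic `((k - 1) ^ 2 - x ^ 2) * ((k + 1) ^ 2 - x ^ 2)` is at most `(k ^ 2 - 1) ^ 2` on
`[-(k - 1), k - 1]` and nonpositive on the rest of `[-(k + 1), k + 1]`, so its mean bounds the
proportion of middle subsets from below. -/
theorem two_pow_mul_le_card_middle {ι : Type*} [Fintype ι] (b : ι → ℝ)
    (hb : ∀ j, b j ∈ Set.Icc (0 : ℝ) 1) {k δ : ℝ} (hk : 1 ≤ k) (hδ : 0 ≤ δ)
    (hsum : ∑ j, b j = k + 1 - 2 * δ) :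
    (2 : ℝ) ^ Fintype.card ι * ((k ^ 2 - 1) ^ 2 - 2 * (k ^ 2 + 2) * ∑ j, b j ^ 2 +
        3 * (∑ j, b j ^ 2) ^ 2) ≤
      (k ^ 2 - 1) ^ 2 *
        #{I : Finset ι | 1 - δ ≤ ∑ j ∈ I, b j ∧ ∑ j ∈ I, b j ≤ ∑ j, b j - (1 - δ)} := by
  classical
  set X : Finset ι → ℝ := fun I => ∑ j, b j - 2 * ∑ j ∈ I, b j with hX
  have hq : ∑ j, b j ^ 4 ≤ ∑ j, b j ^ 2 :=
    sum_le_sum fun j _ => pow_le_pow_of_le_one (hb j).1 (hb j).2 (by norm_num)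
  have h2 : ∑ I, X I ^ 2 = 2 ^ Fintype.card ι * ∑ j, b j ^ 2 := by
    simpa using sum_powerset_sub_two_mul_sum_sq univ b
  have h4 : ∑ I, X I ^ 4 =
      2 ^ Fintype.card ι * (3 * (∑ j, b j ^ 2) ^ 2 - 2 * ∑ j, b j ^ 4) := by
    simpa using sum_powerset_sub_two_mul_sum_pow_four univ b
  have hexp : ∑ I, ((k - 1) ^ 2 - X I ^ 2) * ((k + 1) ^ 2 - X I ^ 2) =
      2 ^ Fintype.card ι * ((k ^ 2 - 1) ^ 2 - 2 * (k ^ 2 + 1) * ∑ j, b j ^ 2 +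
        (3 * (∑ j, b j ^ 2) ^ 2 - 2 * ∑ j, b j ^ 4)) := by
    have : ∀ I, ((k - 1) ^ 2 - X I ^ 2) * ((k + 1) ^ 2 - X I ^ 2) =
        (k ^ 2 - 1) ^ 2 - 2 * (k ^ 2 + 1) * X I ^ 2 + X I ^ 4 := fun I => by ring
    simp_rw [this]
    rw [sum_add_distrib, sum_sub_distrib, ← mul_sum, h2, h4, sum_const, card_univ,
      Fintype.card_finset, nsmul_eq_mul]
    push_cast
    ring
  calc _ ≤ ∑ I, ((k - 1) ^ 2 - X I ^ 2) * ((k + 1) ^ 2 - X I ^ 2) := by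
        rw [hexp]
        refine mul_le_mul_of_nonneg_left ?_ (by positivity)
        linarith
    _ ≤ ∑ I : Finset ι, if 1 - δ ≤ ∑ j ∈ I, b j ∧ ∑ j ∈ I, b j ≤ ∑ j, b j - (1 - δ) then
          (k ^ 2 - 1) ^ 2 else 0 := by
        refine sum_le_sum fun I _ => ?_
        have h0 : 0 ≤ ∑ j ∈ I, b j := sum_nonneg fun j _ => (hb j).1
        have h1 : ∑ j ∈ I, b j ≤ ∑ j, b j :=
          sum_le_sum_of_subset_of_nonneg (subset_univ I) fun j _ _ => (hb j).1
        have hub : X I ^ 2 ≤ (k + 1) ^ 2 := by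
          apply sq_le_sq' <;> simp only [hX] <;> linarith
        split_ifs with h
        · have hmid : X I ^ 2 ≤ (k - 1) ^ 2 := by
            apply sq_le_sq' <;> simp only [hX] <;> linarith
          calc _ ≤ (k - 1) ^ 2 * (k + 1) ^ 2 :=
                mul_le_mul (by linarith [sq_nonneg (X I)]) (by linarith [sq_nonneg (X I)])
                  (by linarith) (sq_nonneg _)
            _ = _ := by ring
        · have hout : (k - 1) ^ 2 ≤ X I ^ 2 := by
            rw [sq_le_sq, abs_of_nonneg (by linarith : 0 ≤ k - 1), le_abs]
            simp only [hX]
            by_contra! hlt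
            exact h ⟨by linarith, by linarith⟩
          exact mul_nonpos_of_nonpos_of_nonneg (by linarith) (by linarith)
    _ = _ := by
        rw [← sum_filter, sum_const, nsmul_eq_mul, mul_comm]

theorem quartic_moment_bound {k s : ℝ} (hk : k = 3 ∨ 4 ≤ k) (hs : s ≤ k + 1) :
    (k - 2) * (k ^ 2 - 1) ^ 2 <
      k * ((k ^ 2 - 1) ^ 2 - 2 * (k ^ 2 + 2) * s + 3 * s ^ 2) := by
  rcases hk with rfl | hk
  · nlinarith [sq_nonneg (s - 11 / 3)]
  · have h : (k + 1) * (2 * (k ^ 2 + 2) - 3 * (k + 1)) ≥ s * (2 * (k ^ 2 + 2) - 3 * s) := by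
      nlinarith [mul_nonneg (sub_nonneg.2 hs) (sub_nonneg.2 hs),
        mul_nonneg (sub_nonneg.2 hs) (by nlinarith : 0 ≤ k ^ 2 - 3 * k - 1)]
    have hk0 : 0 < k := by linarith
    have h' := mul_le_mul_of_nonneg_left h hk0.le
    have : 0 < (k + 1) * (k - 1) * (k - 2) := by
      apply mul_pos (mul_pos _ _) <;> linarith
    nlinarith


/-- For k ≥ 2, δ ∈ [0,1) and b_1,…,b_m ∈ [0,1] with ∑ b_j = k+1−2δ, the number
of subsets I with w(I) < 1−δ is strictly less than 2^m / k; i.e., a uniformly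
random subset has weight less than 1−δ with probability less than 1/k. -/
theorem random_subset_light_probability_lt_one_div_k
    (k : ℕ) (hk : 2 ≤ k) (δ : ℝ) (hδ : δ ∈ Set.Ico (0 : ℝ) 1)
    (m : ℕ) (b : Fin m → ℝ) (hb : ∀ j, b j ∈ Set.Icc (0 : ℝ) 1)
    (hsum : ∑ j, b j = (k : ℝ) + 1 - 2 * δ) :
    (({I : Finset (Fin m) | ∑ j ∈ I, b j < 1 - δ}.ncard : ℝ)) <
      2 ^ m / (k : ℝ) := by
  have hk' : (2 : ℝ) ≤ k := by exact_mod_cast hk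
  obtain ⟨hδ0, hδ1⟩ := hδ
  have hcount := two_mul_card_light_add_card_middle b (c := 1 - δ) (by linarith)
  rw [Fintype.card_fin] at hcount
  have hcard : {I : Finset (Fin m) | ∑ j ∈ I, b j < 1 - δ}.ncard =
      (Finset.univ.filter fun I : Finset (Fin m) => ∑ j ∈ I, b j < 1 - δ).card := by
    rw [← Set.ncard_coe_finset]
    simp
  rw [hcard, lt_div_iff₀ (by linarith)]
  rcases hk.eq_or_lt with rfl | hk3
  · obtain ⟨I, hI1, hI2⟩ := exists_sum_mem_Ico b (fun j => (hb j).2) (c := 1 - δ)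
      (by linarith) (by linarith)
    have hpos : 0 < (Finset.univ.filter fun I : Finset (Fin m) =>
        1 - δ ≤ ∑ j ∈ I, b j ∧ ∑ j ∈ I, b j ≤ ∑ j, b j - (1 - δ)).card := by
      refine Finset.card_pos.2 ⟨I, ?_⟩
      simp only [Finset.mem_filter, Finset.mem_univ, true_and]
      push_cast at hsum
      exact ⟨hI1, by linarith⟩
    norm_cast
    omega
  · have hmid := two_pow_mul_le_card_middle b hb (by linarith) hδ0 hsum
    have hs : ∑ j, b j ^ 2 ≤ (k : ℝ) + 1 :=
      calc _ ≤ ∑ j, b j :=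
            Finset.sum_le_sum fun j _ => pow_le_of_le_one (hb j).1 (hb j).2 two_ne_zero
        _ ≤ _ := by linarith
    have hpoly := quartic_moment_bound (k := k) (s := ∑ j, b j ^ 2)
      (by rcases (show k = 3 ∨ 4 ≤ k by omega) with h | h
          · exact .inl (by exact_mod_cast h)
          · exact .inr (by exact_mod_cast h)) hs
    rw [Fintype.card_fin] at hmid
    have hcountR := congrArg (Nat.cast : ℕ → ℝ) hcount
    push_cast at hcountR
    have hA : (0 : ℝ) < ((k : ℝ) ^ 2 - 1) ^ 2 := pow_pos (by nlinarith) 2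
    have h1 := mul_lt_mul_of_pos_left hpoly (pow_pos two_pos m : (0 : ℝ) < 2 ^ m)
    have h2 := mul_le_mul_of_nonneg_left hmid (by linarith : (0 : ℝ) ≤ k)
    refine lt_of_mul_lt_mul_left ?_ hA.le
    rw [← hcountR] at h1 h2 ⊢
    linarith
end

section
/- Let k ≥ 2 be an integer, let δ ∈ [0,1), and let b_1, …, b_m ∈ [0,1] be reals with ∑_{j=1}^m b_j = k+1−2δ. Let z = ⌈(k+1)/2⌉. Then there exist pairwise disjoint sets C_1, …, C_z ⊆ {1,…,m} such that 1−δ ≤ ∑_{j ∈ C_ℓ} b_j < 2−δ for every ℓ ∈ {1,…,z}. -/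
/-- If all weights are at most 1 and the total weight is at least `t > 0`, some subset has weight
in `[t, t + 1)`. -/
theorem exists_subset_sum_mem_Ico {ι : Type*} {b : ι → ℝ} (hb : ∀ j, b j ≤ 1) {t : ℝ}
    (ht : 0 < t) (s : Finset ι) (hs : t ≤ ∑ j ∈ s, b j) :
    ∃ C ⊆ s, t ≤ ∑ j ∈ C, b j ∧ ∑ j ∈ C, b j < t + 1 := by
  classical
  induction s using Finset.induction_on with
  | empty => simp at hs; linarith
  | insert a s ha ih =>
    by_cases h : t ≤ ∑ j ∈ s, b j
    · obtain ⟨C, hC, hw⟩ := ih h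
      exact ⟨C, hC.trans (Finset.subset_insert a s), hw⟩
    · refine ⟨insert a s, subset_rfl, hs, ?_⟩
      rw [Finset.sum_insert ha]
      linarith [hb a]

/-- If all weights are at most 1 and the total weight is at least `n (t + 1) - 1` with `t > 0`,
there are `n` pairwise disjoint subsets with weights in `[t, t + 1)`. -/
theorem exists_disjoint_subsets_sum_mem_Ico {ι : Type*} {b : ι → ℝ} (hb : ∀ j, b j ≤ 1) {t : ℝ}
    (ht : 0 < t) (n : ℕ) (s : Finset ι) (hs : n * (t + 1) - 1 ≤ ∑ j ∈ s, b j) :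
    ∃ C : Fin n → Finset ι, (∀ i, C i ⊆ s) ∧ (∀ i j, i ≠ j → Disjoint (C i) (C j)) ∧
      ∀ i, t ≤ ∑ j ∈ C i, b j ∧ ∑ j ∈ C i, b j < t + 1 := by
  classical
  induction n generalizing s with
  | zero => exact ⟨Fin.elim0, fun i => i.elim0, fun i => i.elim0, fun i => i.elim0⟩
  | succ n ih =>
    push_cast at hs
    have hn : 0 ≤ (n : ℝ) * (t + 1) := by positivity
    obtain ⟨D, hD, hw⟩ := exists_subset_sum_mem_Ico hb ht s (by linarith)
    have hsplit := Finset.sum_sdiff hD (f := b)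
    obtain ⟨C, hCs, hCd, hCw⟩ := ih (s \ D) (by linarith [hw.2])
    have hdisj (i : Fin n) : Disjoint D (C i) := Finset.disjoint_sdiff.mono_right (hCs i)
    refine ⟨Fin.cons D C, Fin.cases hD fun i => (hCs i).trans Finset.sdiff_subset, ?_,
      Fin.cases hw hCw⟩
    intro i j hij
    cases i using Fin.cases <;> cases j using Fin.cases
    · exact absurd rfl hij
    · exact hdisj _
    · exact (hdisj _).symm
    · exact hCd _ _ (fun h => hij (congrArg Fin.succ h))


/-- For k ≥ 2, δ ∈ [0,1) and b_1,…,b_m ∈ [0,1] with ∑ b_j = k+1−2δ, there exist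
z = ⌈(k+1)/2⌉ pairwise disjoint sets C_1,…,C_z whose weights lie in [1−δ, 2−δ). -/
theorem exists_disjoint_sets_with_medium_weight
    (k : ℕ) (hk : 2 ≤ k) (δ : ℝ) (hδ : δ ∈ Set.Ico (0 : ℝ) 1)
    (m : ℕ) (b : Fin m → ℝ) (hb : ∀ j, b j ∈ Set.Icc (0 : ℝ) 1)
    (hsum : ∑ j, b j = (k : ℝ) + 1 - 2 * δ)
    (z : ℕ) (hz : z = ⌈((k : ℝ) + 1) / 2⌉₊) :
    ∃ C : Fin z → Finset (Fin m),
      (∀ i j, i ≠ j → Disjoint (C i) (C j)) ∧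
      ∀ ℓ, 1 - δ ≤ ∑ j ∈ C ℓ, b j ∧ ∑ j ∈ C ℓ, b j < 2 - δ := by
  have hz_lt : (z : ℝ) < ((k : ℝ) + 1) / 2 + 1 := hz ▸ Nat.ceil_lt_add_one (by positivity)
  have hz_le : 2 * z ≤ k + 2 := by
    have : 2 * z < k + 3 := by exact_mod_cast (by linarith : (2 : ℝ) * z < k + 3)
    omega
  have hz_two : 2 ≤ z := by
    rw [hz, Nat.succ_le_iff, Nat.lt_ceil]
    have : (2 : ℝ) ≤ k := by exact_mod_cast hk
    push_cast
    linarith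
  have hz_le' : (2 : ℝ) * z ≤ k + 2 := by exact_mod_cast hz_le
  have hz_two' : (2 : ℝ) ≤ z := by exact_mod_cast hz_two
  obtain ⟨C, -, hCd, hCw⟩ := exists_disjoint_subsets_sum_mem_Ico (fun j => (hb j).2)
    (sub_pos.2 hδ.2) z Finset.univ (by nlinarith [mul_nonneg (sub_nonneg.2 hz_two') hδ.1])
  exact ⟨C, hCd, fun i => ⟨(hCw i).1, by linarith [(hCw i).2]⟩⟩
end

section
/- Let δ ∈ [0,1), let b_1, …, b_m be nonnegative reals, and write w(S) = ∑_{j ∈ S} b_j for S ⊆ {1,…,m}. Let C_1, …, C_z ⊆ {1,…,m} be pairwise disjoint sets with 1−δ ≤ w(C_ℓ) < 2−δ for every ℓ. Then the number of subsets I ⊆ {1,…,m} with w(I) < 1−δ is at most 2^{m−z+1}. -/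
open Finset in
/-- Two sets whose union contains two disjoint sets `A` and `B` of weight at least `T`
cannot both have weight less than `T`. -/
lemma not_light_of_cover_two_blocks {α : Type*} [DecidableEq α] {T : ℝ} {b : α → ℝ}
    (hb : ∀ j, 0 ≤ b j) {A B I J : Finset α} (hAB : Disjoint A B)
    (hA : T ≤ ∑ j ∈ A, b j) (hB : T ≤ ∑ j ∈ B, b j)
    (hAu : A ⊆ I ∪ J) (hBu : B ⊆ I ∪ J)
    (hI : ∑ j ∈ I, b j < T) (hJ : ∑ j ∈ J, b j < T) : False := by
  have h1 : ∑ j ∈ A ∪ B, b j ≤ ∑ j ∈ I ∪ J, b j :=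
    sum_le_sum_of_subset_of_nonneg (union_subset hAu hBu) fun j _ _ => hb j
  have h2 := sum_union_inter (s₁ := I) (s₂ := J) (f := b)
  have h3 : 0 ≤ ∑ j ∈ I ∩ J, b j := sum_nonneg fun j _ => hb j
  rw [sum_union hAB] at h1
  linarith

open Classical in
/-- The representative of the class of `I` modulo symmetric differences with the blocks `C ℓ`
which avoids all the base points `r ℓ ∈ C ℓ`. -/
noncomputable def blockRepresentative {α κ : Type*} [Fintype α] (C : κ → Finset α) (r : κ → α)
    (I : Finset α) : Finset α :=
  Finset.univ.filter fun j => j ∉ Set.range r ∧ ¬ (j ∈ I ↔ ∃ ℓ, j ∈ C ℓ ∧ r ℓ ∈ I)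

section blockRepresentative

variable {α κ : Type*} [Fintype α] {C : κ → Finset α} {r : κ → α} {I J : Finset α}

lemma notMem_range_of_mem_blockRepresentative {x : α} (hx : x ∈ blockRepresentative C r I) :
    x ∉ Set.range r := by
  simp only [blockRepresentative, Finset.mem_filter] at hx
  exact hx.2.1

lemma mem_iff_mem_iff_of_blockRepresentative_eq
    (hdisj : ∀ i j, i ≠ j → Disjoint (C i) (C j)) (hr : ∀ ℓ, r ℓ ∈ C ℓ)
    (h : blockRepresentative C r I = blockRepresentative C r J) {ℓ : κ} {x : α} (hx : x ∈ C ℓ) :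
    (x ∈ I ↔ x ∈ J) ↔ (r ℓ ∈ I ↔ r ℓ ∈ J) := by
  have huniq : ∀ k, x ∈ C k → k = ℓ := fun k hk => by
    by_contra hne
    exact Finset.disjoint_left.mp (hdisj k ℓ hne) hk hx
  by_cases hxr : x ∈ Set.range r
  · obtain ⟨k, rfl⟩ := hxr
    rw [huniq k (hr k)]
  · have hblock : ∀ K : Finset α, (∃ k, x ∈ C k ∧ r k ∈ K) ↔ r ℓ ∈ K := fun K =>
      ⟨fun ⟨k, hk, hK⟩ => huniq k hk ▸ hK, fun hK => ⟨ℓ, hx, hK⟩⟩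
    have h' := Finset.ext_iff.mp h x
    simp only [blockRepresentative, Finset.mem_filter, Finset.mem_univ, true_and, hxr,
      not_false_eq_true, hblock] at h'
    tauto

lemma eq_of_blockRepresentative_eq
    (hdisj : ∀ i j, i ≠ j → Disjoint (C i) (C j)) (hr : ∀ ℓ, r ℓ ∈ C ℓ)
    (h : blockRepresentative C r I = blockRepresentative C r J)
    (hrIJ : ∀ ℓ, r ℓ ∈ I ↔ r ℓ ∈ J) : I = J := by
  ext x
  by_cases hx : ∃ ℓ, x ∈ C ℓ
  · obtain ⟨ℓ, hℓ⟩ := hx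
    exact (mem_iff_mem_iff_of_blockRepresentative_eq hdisj hr h hℓ).mpr (hrIJ ℓ)
  · have hxr : x ∉ Set.range r := by
      rintro ⟨ℓ, rfl⟩
      exact hx ⟨ℓ, hr ℓ⟩
    have hblock : ∀ K : Finset α, ¬ ∃ k, x ∈ C k ∧ r k ∈ K := fun K ⟨k, hk, _⟩ => hx ⟨k, hk⟩
    have h' := Finset.ext_iff.mp h x
    simp only [blockRepresentative, Finset.mem_filter, Finset.mem_univ, true_and, hxr,
      not_false_eq_true, hblock] at h'
    tauto

lemma subset_union_of_blockRepresentative_eq [DecidableEq α]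
    (hdisj : ∀ i j, i ≠ j → Disjoint (C i) (C j)) (hr : ∀ ℓ, r ℓ ∈ C ℓ)
    (h : blockRepresentative C r I = blockRepresentative C r J) {ℓ : κ}
    (hne : ¬ (r ℓ ∈ I ↔ r ℓ ∈ J)) : C ℓ ⊆ I ∪ J := by
  intro x hx
  have := mem_iff_mem_iff_of_blockRepresentative_eq hdisj hr h hx
  rw [Finset.mem_union]
  tauto

end blockRepresentative

/-- Given pairwise disjoint sets C_1,…,C_z of weight in [1−δ, 2−δ) (δ ∈ [0,1),
nonnegative weights), the number of subsets I with w(I) < 1−δ is at most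
2^(m−z+1). -/
theorem light_subsets_card_le
    (δ : ℝ) (hδ : δ ∈ Set.Ico (0 : ℝ) 1)
    (m : ℕ) (b : Fin m → ℝ) (hb : ∀ j, 0 ≤ b j)
    (z : ℕ) (C : Fin z → Finset (Fin m))
    (hdisj : ∀ i j, i ≠ j → Disjoint (C i) (C j))
    (hC : ∀ ℓ, 1 - δ ≤ ∑ j ∈ C ℓ, b j ∧ ∑ j ∈ C ℓ, b j < 2 - δ) :
    {I : Finset (Fin m) | ∑ j ∈ I, b j < 1 - δ}.ncard ≤ 2 ^ (m - z + 1) := by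
  classical
  have hT : 0 < 1 - δ := by linarith [hδ.2]
  have hne : ∀ ℓ, (C ℓ).Nonempty := fun ℓ => by
    rw [Finset.nonempty_iff_ne_empty]
    intro h
    have := (hC ℓ).1
    rw [h, Finset.sum_empty] at this
    linarith
  choose r hr using hne
  have hr_inj : Function.Injective r := fun i j hij => by
    by_contra h
    exact Finset.disjoint_left.mp (hdisj i j h) (hr i) (hij ▸ hr j)
  set light := Finset.univ.filter fun I : Finset (Fin m) => ∑ j ∈ I, b j < 1 - δ with hlight
  have hset : {I : Finset (Fin m) | ∑ j ∈ I, b j < 1 - δ} = (light : Set (Finset (Fin m))) := by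
    simp [hlight]
  rw [hset, Set.ncard_coe_finset]
  have hmaps : ∀ I ∈ light, blockRepresentative C r I ∈ ((Finset.univ.image r)ᶜ).powerset := by
    intro I _
    rw [Finset.mem_powerset]
    intro x hx
    simpa using notMem_range_of_mem_blockRepresentative hx
  have hfiber : ∀ R ∈ ((Finset.univ.image r)ᶜ).powerset,
      (light.filter fun I => blockRepresentative C r I = R).card ≤ 2 := by
    intro R _
    by_contra! hcard
    obtain ⟨I, hI, J, hJ, K, hK, hIJ, hIK, hJK⟩ := Finset.two_lt_card.mp hcard
    simp only [hlight, Finset.mem_filter, Finset.mem_univ, true_and] at hI hJ hK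
    have hsep : ∀ {A B : Finset (Fin m)}, blockRepresentative C r A = R →
        blockRepresentative C r B = R → A ≠ B → ∃ ℓ, ¬ (r ℓ ∈ A ↔ r ℓ ∈ B) := by
      intro A B hA hB hAB
      by_contra! h
      exact hAB (eq_of_blockRepresentative_eq hdisj hr (hA.trans hB.symm) h)
    have huniq : ∀ {A B : Finset (Fin m)},
        (∑ j ∈ A, b j < 1 - δ ∧ blockRepresentative C r A = R) →
        (∑ j ∈ B, b j < 1 - δ ∧ blockRepresentative C r B = R) →
        ∀ i j, ¬ (r i ∈ A ↔ r i ∈ B) → ¬ (r j ∈ A ↔ r j ∈ B) → i = j := by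
      intro A B hA hB i j hi hj
      by_contra hij
      have h := hA.2.trans hB.2.symm
      exact not_light_of_cover_two_blocks hb (hdisj i j hij) (hC i).1 (hC j).1
        (subset_union_of_blockRepresentative_eq hdisj hr h hi)
        (subset_union_of_blockRepresentative_eq hdisj hr h hj) hA.1 hB.1
    obtain ⟨i, hi⟩ := hsep hI.2 hJ.2 hIJ
    obtain ⟨j, hj⟩ := hsep hJ.2 hK.2 hJK
    obtain ⟨k, hk⟩ := hsep hI.2 hK.2 hIK
    have h1 := huniq hI hJ
    have h2 := huniq hJ hK
    have h3 := huniq hI hK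
    by_cases hkJ : r k ∈ J <;> by_cases hjI : r j ∈ I <;> by_cases hiK : r i ∈ K <;> grind only
  have hcard := Finset.card_le_mul_card_image_of_maps_to hmaps 2 hfiber
  rw [Finset.card_powerset, Finset.card_compl, Finset.card_image_of_injective _ hr_inj,
    Finset.card_univ, Fintype.card_fin, Fintype.card_fin] at hcard
  rwa [pow_succ']
end

section
/- Let δ ∈ [0,1), let b_1, …, b_m be nonnegative reals, and write w(S) = ∑_{j ∈ S} b_j for S ⊆ {1,…,m}. Let C_1, …, C_z ⊆ {1,…,m} be pairwise disjoint sets with 1−δ ≤ w(C_ℓ) < 2−δ for every ℓ. Then every union of a nonempty subfamily of {C_1, …, C_z} has weight at least 1−δ, and consequently the number of subsets I ⊆ {1,…,m} with w(I) < 1−δ is at most 2^{m−z+1} − 1. -/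
/-- Disjoint blocks `C ℓ ∋ c ℓ`: flip, inside `I`, every block whose marked point lies in `I`. The
result is a canonical representative of `I` modulo symmetric differences with blocks. -/
def blockReduce {α ι : Type*} [Fintype α] [DecidableEq α] [Fintype ι]
    (C : ι → Finset α) (c : ι → α) (I : Finset α) : Finset α :=
  {j | ¬(j ∈ I ↔ ∃ ℓ, j ∈ C ℓ ∧ c ℓ ∈ I)}

/-- The indices of the blocks whose marked point lies in `I`. -/
def markedBlocks {α ι : Type*} [DecidableEq α] [Fintype ι]
    (c : ι → α) (I : Finset α) : Finset ι :=
  {ℓ | c ℓ ∈ I}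

lemma card_eq_add_one_of_symmDiff_singleton {ι : Type*} [DecidableEq ι] {A B : Finset ι} {ℓ : ι}
    (hA : ℓ ∈ A) (hB : ℓ ∉ B) (h : ∀ k, k ≠ ℓ → (k ∈ A ↔ k ∈ B)) :
    A.card = B.card + 1 := by
  rw [← Finset.card_insert_of_notMem hB]
  congr 1
  ext k
  by_cases hk : k = ℓ
  · simp [hk, hA]
  · simp [hk, h k hk]

lemma exists_mem_block_and_marked_iff {α ι : Type*} {C : ι → Finset α} {c : ι → α}
    (hdisj : ∀ i j, i ≠ j → Disjoint (C i) (C j))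
    {I : Finset α} {ℓ : ι} {j : α} (hj : j ∈ C ℓ) :
    (∃ k, j ∈ C k ∧ c k ∈ I) ↔ c ℓ ∈ I := by
  refine ⟨?_, fun h => ⟨ℓ, hj, h⟩⟩
  rintro ⟨k, hk, hck⟩
  by_cases h : k = ℓ
  · exact h ▸ hck
  · exact absurd hj (Finset.disjoint_left.mp (hdisj k ℓ h) hk)

section Blocks

variable {α ι : Type*} [Fintype α] [DecidableEq α] [Fintype ι]
  {C : ι → Finset α} {c : ι → α}

lemma mem_blockReduce_of_mem_block (hdisj : ∀ i j, i ≠ j → Disjoint (C i) (C j))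
    {I : Finset α} {ℓ : ι} {j : α} (hj : j ∈ C ℓ) :
    j ∈ blockReduce C c I ↔ ¬(j ∈ I ↔ c ℓ ∈ I) := by
  simp [blockReduce, exists_mem_block_and_marked_iff hdisj hj]

lemma marked_notMem_blockReduce (hdisj : ∀ i j, i ≠ j → Disjoint (C i) (C j))
    (hc : ∀ ℓ, c ℓ ∈ C ℓ) (I : Finset α) (ℓ : ι) : c ℓ ∉ blockReduce C c I := by
  simp [mem_blockReduce_of_mem_block hdisj (hc ℓ)]

lemma eq_of_blockReduce_eq_of_markedBlocks_eq {I J : Finset α}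
    (hR : blockReduce C c I = blockReduce C c J)
    (hM : markedBlocks c I = markedBlocks c J) : I = J := by
  ext j
  have hM' : ∀ ℓ, c ℓ ∈ I ↔ c ℓ ∈ J := fun ℓ => by
    simpa [markedBlocks] using congrArg (ℓ ∈ ·) hM
  have hj := congrArg (j ∈ ·) hR
  simp only [blockReduce, Finset.mem_filter, Finset.mem_univ, true_and, hM', eq_iff_iff,
    not_iff_not] at hj
  by_cases h : ∃ ℓ, j ∈ C ℓ ∧ c ℓ ∈ J <;> simp only [h, iff_true, iff_false] at hj <;> tauto

lemma block_subset_union (hdisj : ∀ i j, i ≠ j → Disjoint (C i) (C j)) {I J : Finset α}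
    (hR : blockReduce C c I = blockReduce C c J) {ℓ : ι} (hℓ : ¬(c ℓ ∈ I ↔ c ℓ ∈ J)) :
    C ℓ ⊆ I ∪ J := by
  intro j hj
  have h := congrArg (j ∈ ·) hR
  simp only [mem_blockReduce_of_mem_block hdisj hj, eq_iff_iff] at h
  rw [Finset.mem_union]
  tauto

/-- Two sets of weight less than `t` in the same class differ in at most one block when all blocks
weigh at least `t`. -/
lemma eq_of_marked_ne (hdisj : ∀ i j, i ≠ j → Disjoint (C i) (C j))
    {b : α → ℝ} (hb : ∀ j, 0 ≤ b j) {t : ℝ} (hC : ∀ ℓ, t ≤ ∑ j ∈ C ℓ, b j)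
    {I J : Finset α} (hI : ∑ j ∈ I, b j < t) (hJ : ∑ j ∈ J, b j < t)
    (hR : blockReduce C c I = blockReduce C c J) {k ℓ : ι}
    (hk : ¬(c k ∈ I ↔ c k ∈ J)) (hℓ : ¬(c ℓ ∈ I ↔ c ℓ ∈ J)) : k = ℓ := by
  by_contra hne
  have hsub : C k ∪ C ℓ ⊆ I ∪ J :=
    Finset.union_subset (block_subset_union hdisj hR hk) (block_subset_union hdisj hR hℓ)
  have h₁ := Finset.sum_le_sum_of_subset_of_nonneg hsub (f := b) fun j _ _ => hb j
  rw [Finset.sum_union (hdisj k ℓ hne)] at h₁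
  have h₂ := Finset.sum_union_inter (s₁ := I) (s₂ := J) (f := b)
  have h₃ : 0 ≤ ∑ j ∈ I ∩ J, b j := Finset.sum_nonneg fun j _ => hb j
  linarith [hC k, hC ℓ]

lemma eq_of_blockReduce_eq_of_parity_eq (hdisj : ∀ i j, i ≠ j → Disjoint (C i) (C j))
    {b : α → ℝ} (hb : ∀ j, 0 ≤ b j) {t : ℝ} (hC : ∀ ℓ, t ≤ ∑ j ∈ C ℓ, b j)
    {I J : Finset α} (hI : ∑ j ∈ I, b j < t) (hJ : ∑ j ∈ J, b j < t)
    (hR : blockReduce C c I = blockReduce C c J)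
    (hP : Even (markedBlocks c I).card ↔ Even (markedBlocks c J).card) : I = J := by
  classical
  refine eq_of_blockReduce_eq_of_markedBlocks_eq hR ?_
  by_contra hne
  obtain ⟨ℓ, hℓ⟩ : ∃ ℓ, ¬(c ℓ ∈ I ↔ c ℓ ∈ J) := by
    by_contra! h
    exact hne (by ext ℓ; simp [markedBlocks, h ℓ])
  have hoff : ∀ k, k ≠ ℓ → (c k ∈ I ↔ c k ∈ J) := fun k hk => by
    by_contra h
    exact hk (eq_of_marked_ne hdisj hb hC hI hJ hR h hℓ)
  by_cases hℓI : c ℓ ∈ I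
  · have := card_eq_add_one_of_symmDiff_singleton (A := markedBlocks c I)
      (B := markedBlocks c J) (ℓ := ℓ) (by simpa [markedBlocks] using hℓI)
      (by simp only [markedBlocks, Finset.mem_filter, Finset.mem_univ, true_and]; tauto)
      (fun k hk => by simpa [markedBlocks] using hoff k hk)
    rw [this, Nat.even_add_one] at hP
    tauto
  · have := card_eq_add_one_of_symmDiff_singleton (A := markedBlocks c J)
      (B := markedBlocks c I) (ℓ := ℓ)
      (by simp only [markedBlocks, Finset.mem_filter, Finset.mem_univ, true_and]; tauto)
      (by simpa [markedBlocks] using hℓI)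
      (fun k hk => by simpa [markedBlocks] using (hoff k hk).symm)
    rw [this, Nat.even_add_one] at hP
    tauto

lemma markedBlocks_eq_empty_of_blockReduce_eq_empty
    (hdisj : ∀ i j, i ≠ j → Disjoint (C i) (C j))
    {b : α → ℝ} (hb : ∀ j, 0 ≤ b j) {t : ℝ} (hC : ∀ ℓ, t ≤ ∑ j ∈ C ℓ, b j)
    {I : Finset α} (hI : ∑ j ∈ I, b j < t) (hR : blockReduce C c I = ∅) :
    markedBlocks c I = ∅ := by
  refine Finset.eq_empty_of_forall_notMem fun ℓ hℓ => ?_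
  have hℓI : c ℓ ∈ I := by simpa [markedBlocks] using hℓ
  have hsub : C ℓ ⊆ I := fun j hj => by
    have h : j ∉ blockReduce C c I := by simp [hR]
    rw [mem_blockReduce_of_mem_block hdisj hj] at h
    tauto
  have := Finset.sum_le_sum_of_subset_of_nonneg hsub (f := b) fun j _ _ => hb j
  linarith [hC ℓ]

/-- If all the disjoint blocks weigh at least `t > 0`, then fewer than `2 ^ (|α| - |ι| + 1)` sets
weigh less than `t`. -/
lemma ncard_light_le (hdisj : ∀ i j, i ≠ j → Disjoint (C i) (C j))
    {b : α → ℝ} (hb : ∀ j, 0 ≤ b j) {t : ℝ} (ht : 0 < t) (hC : ∀ ℓ, t ≤ ∑ j ∈ C ℓ, b j) :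
    {I : Finset α | ∑ j ∈ I, b j < t}.ncard ≤
      2 ^ (Fintype.card α - Fintype.card ι + 1) - 1 := by
  have hne : ∀ ℓ, (C ℓ).Nonempty := fun ℓ => by
    by_contra h
    have := hC ℓ
    rw [Finset.not_nonempty_iff_eq_empty.mp h, Finset.sum_empty] at this
    linarith
  choose c hc using hne
  have hinj : Function.Injective c := fun k ℓ h => by
    by_contra hkℓ
    exact Finset.disjoint_left.mp (hdisj k ℓ hkℓ) (hc k) (h ▸ hc ℓ)
  set K : Finset α := (Finset.univ.image c)ᶜ with hK
  have hKcard : K.card = Fintype.card α - Fintype.card ι := by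
    rw [hK, Finset.card_compl, Finset.card_image_of_injective _ hinj, Finset.card_univ]
  set T : Finset (Finset α × Bool) :=
    (K.powerset ×ˢ Finset.univ).erase (∅, false) with hT
  have hTcard : T.card = 2 ^ (Fintype.card α - Fintype.card ι + 1) - 1 := by
    rw [hT, Finset.card_erase_of_mem (by simp), Finset.card_product, Finset.card_powerset, hKcard,
      Finset.card_univ, Fintype.card_bool, pow_succ]
  rw [← hTcard, ← Set.ncard_coe_finset]
  refine Set.ncard_le_ncard_of_injOn
    (fun I => (blockReduce C c I, decide (Even (markedBlocks c I).card))) ?_ ?_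
    (Finset.finite_toSet T)
  · intro I hI
    have hsub : blockReduce C c I ⊆ K := fun j hj => by
      rw [hK, Finset.mem_compl, Finset.mem_image]
      rintro ⟨ℓ, -, rfl⟩
      exact marked_notMem_blockReduce hdisj hc I ℓ hj
    rw [hT, Finset.mem_coe, Finset.mem_erase]
    refine ⟨fun h => ?_, Finset.mem_product.mpr ⟨Finset.mem_powerset.mpr hsub, Finset.mem_univ _⟩⟩
    rw [Prod.mk.injEq] at h
    have hM := markedBlocks_eq_empty_of_blockReduce_eq_empty hdisj hb hC hI h.1
    simp [hM] at h
  · intro I hI J hJ h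
    rw [Prod.mk.injEq, decide_eq_decide] at h
    exact eq_of_blockReduce_eq_of_parity_eq hdisj hb hC hI hJ h.1 h.2

end Blocks

/-- Given pairwise disjoint sets C_1,…,C_z of weight in [1−δ, 2−δ) (δ ∈ [0,1),
nonnegative weights): every union of a nonempty subfamily of the C_ℓ has weight
at least 1−δ, and the number of subsets I with w(I) < 1−δ is at most
2^(m−z+1) − 1. -/
theorem light_subsets_card_le_improved
    (δ : ℝ) (hδ : δ ∈ Set.Ico (0 : ℝ) 1)
    (m : ℕ) (b : Fin m → ℝ) (hb : ∀ j, 0 ≤ b j)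
    (z : ℕ) (C : Fin z → Finset (Fin m))
    (hdisj : ∀ i j, i ≠ j → Disjoint (C i) (C j))
    (hC : ∀ ℓ, 1 - δ ≤ ∑ j ∈ C ℓ, b j ∧ ∑ j ∈ C ℓ, b j < 2 - δ) :
    (∀ T : Finset (Fin z), T.Nonempty → 1 - δ ≤ ∑ j ∈ T.biUnion C, b j) ∧
    {I : Finset (Fin m) | ∑ j ∈ I, b j < 1 - δ}.ncard ≤ 2 ^ (m - z + 1) - 1 := by
  refine ⟨?_, ?_⟩
  · rintro T ⟨ℓ, hℓ⟩
    exact (hC ℓ).1.trans (Finset.sum_le_sum_of_subset_of_nonneg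
      (Finset.subset_biUnion_of_mem C hℓ) fun j _ _ => hb j)
  · simpa using ncard_light_le hdisj hb (sub_pos.mpr hδ.2) fun ℓ => (hC ℓ).1
end

section
/- Let k ≥ 4 be an integer. Let E_1, …, E_m be pairwise disjoint sets of exactly 3 edges each, with a nonnegative real weight w(e) for every edge, such that ∑_{j=1}^m ∑_{e ∈ E_j} w(e) = k and w(e) ≤ 1 for every edge e. From each E_j remove one edge chosen uniformly at random, independently across j, and let X be the total weight of the edges that remain. Then Pr(X < 1) ≤ exp(−2·(2k/3 − 1)²/k), and moreover exp(−2·(2k/3 − 1)²/k) < 1/k. -/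
open MeasureTheory ProbabilityTheory in
/-- **Hoeffding's lemma** for the uniform distribution on a finite set. -/
theorem Finset.sum_exp_le_of_mem_Icc {α : Type*} (s : Finset α) (hs : s.Nonempty) (f : α → ℝ)
    {a b : ℝ} (hf : ∀ x ∈ s, f x ∈ Set.Icc a b) (t : ℝ) :
    ∑ x ∈ s, Real.exp (t * f x) ≤
      s.card * Real.exp (t * ((∑ x ∈ s, f x) / s.card) + t ^ 2 * (b - a) ^ 2 / 8) := by
  have hn : (0 : ℝ) < s.card := by exact_mod_cast hs.card_pos
  let μ : Measure ℝ := ∑ x ∈ s, (s.card : ENNReal)⁻¹ • Measure.dirac (f x)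
  have hμ : IsProbabilityMeasure μ := by
    refine ⟨?_⟩
    simp only [μ, Measure.coe_finsetSum, Finset.sum_apply, Measure.smul_apply, measure_univ,
      smul_eq_mul, mul_one, Finset.sum_const, nsmul_eq_mul]
    exact ENNReal.mul_inv_cancel (by exact_mod_cast hs.card_pos.ne') (ENNReal.natCast_ne_top _)
  have hint (g : ℝ → ℝ) : ∫ y, g y ∂μ = (∑ x ∈ s, g (f x)) / s.card := by
    rw [integral_finsetSum_measure]
    · simp [integral_smul_measure, Finset.mul_sum, div_eq_inv_mul]
    · intro x _
      exact (integrable_dirac (by simp)).smul_measure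
        (ENNReal.inv_ne_top.2 (by exact_mod_cast hs.card_pos.ne'))
  have hmem : ∀ᵐ y ∂μ, id y ∈ Set.Icc a b := by
    simp only [ae_iff, μ, Measure.coe_finsetSum, Finset.sum_apply, Measure.smul_apply,
      smul_eq_mul]
    refine Finset.sum_eq_zero fun x hx => ?_
    have := hf x hx
    simp_all
  have h := (hasSubgaussianMGF_of_mem_Icc aemeasurable_id hmem).mgf_le t
  rw [mgf, hint, hint] at h
  simp only [id, mul_sub, Real.exp_sub] at h
  rw [← Finset.sum_div, div_div, div_le_iff₀ (by positivity), ← mul_assoc, mul_comm,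
    ← mul_assoc] at h
  refine h.trans (le_of_eq ?_)
  rw [mul_right_comm, mul_assoc, ← Real.exp_add]
  simp only [NNReal.coe_pow, NNReal.coe_div, coe_nnnorm, Real.norm_eq_abs, NNReal.coe_ofNat,
    div_pow, sq_abs]
  ring_nf

theorem exp_neg_two_mul_sq_div_lt_one_div {x : ℝ} (hx : 4 ≤ x) :
    Real.exp (-(2 * (2 * x / 3 - 1) ^ 2) / x) < 1 / x := by
  have hx0 : 0 < x := by linarith
  rw [one_div, ← Real.exp_log (inv_pos.2 hx0), Real.exp_lt_exp, Real.log_inv, neg_div, neg_lt_neg_iff]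
  have hlog4 : Real.log 4 < 25 / 18 := by
    rw [show (4 : ℝ) = 2 ^ 2 by norm_num, Real.log_pow]
    have := Real.log_two_lt_d9
    push_cast
    linarith
  have hlog : Real.log x ≤ Real.log 4 + (x / 4 - 1) := by
    have h := Real.log_le_sub_one_of_pos (show 0 < x / 4 by positivity)
    rw [Real.log_div hx0.ne' (by norm_num)] at h
    linarith
  have hlin : 25 / 18 + (x / 4 - 1) ≤ 2 * (2 * x / 3 - 1) ^ 2 / x := by
    rw [le_div_iff₀ hx0]
    nlinarith
  linarith


/-- For k ≥ 4 and pairwise disjoint 3-edge cycles of total weight k with each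
edge of weight at most 1: if one uniformly random edge is removed from each
cycle independently, the probability that the remaining weight X is less than 1
is at most exp(−2(2k/3 − 1)²/k), and this bound is less than 1/k. -/
theorem hoeffding_bound_for_random_decomposition
    (k : ℕ) (hk : 4 ≤ k) {α : Type*} [DecidableEq α]
    (m : ℕ) (E : Fin m → Finset α)
    (hdisj : ∀ i j, i ≠ j → Disjoint (E i) (E j))
    (hcard : ∀ j, (E j).card = 3)
    (w : α → ℝ) (hw : ∀ e, 0 ≤ w e)
    (htot : ∑ j, ∑ e ∈ E j, w e = (k : ℝ))
    (hle : ∀ j, ∀ e ∈ E j, w e ≤ 1) :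
    (({c : Fin m → α | (∀ j, c j ∈ E j) ∧
          ∑ j, ∑ e ∈ (E j).erase (c j), w e < 1}.ncard : ℝ) / 3 ^ m ≤
        Real.exp (-(2 * (2 * (k : ℝ) / 3 - 1) ^ 2) / (k : ℝ))) ∧
    Real.exp (-(2 * (2 * (k : ℝ) / 3 - 1) ^ 2) / (k : ℝ)) < 1 / (k : ℝ) := by
  have hk4 : (4 : ℝ) ≤ k := by exact_mod_cast hk
  have hk0 : (0 : ℝ) < k := by linarith
  refine ⟨?_, exp_neg_two_mul_sq_div_lt_one_div hk4⟩
  set t : ℝ := 4 * (2 * k / 3 - 1) / k with ht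
  have ht0 : 0 ≤ t := div_nonneg (by linarith) hk0.le
  have hfactor (j : Fin m) : ∑ x ∈ E j, Real.exp (t * w x) ≤
      3 * Real.exp ((t / 3 + t ^ 2 / 8) * ∑ e ∈ E j, w e) := by
    have hne : (E j).Nonempty := Finset.card_pos.1 (by simp [hcard])
    obtain ⟨y, hy, hmax⟩ := (E j).exists_max_image w hne
    have h := (E j).sum_exp_le_of_mem_Icc hne w (fun x hx => ⟨hw x, hmax x hx⟩) t
    rw [hcard] at h
    refine h.trans ?_
    have hyW : w y ≤ ∑ e ∈ E j, w e := Finset.single_le_sum (fun e _ => hw e) hy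
    have hsq : (w y - 0) ^ 2 ≤ ∑ e ∈ E j, w e := by nlinarith [hw y, hle j y hy]
    push_cast
    gcongr
    nlinarith [mul_le_mul_of_nonneg_left hsq (sq_nonneg t)]
  have hset : {c : Fin m → α | (∀ j, c j ∈ E j) ∧ ∑ j, ∑ e ∈ (E j).erase (c j), w e < 1} =
      ((Fintype.piFinset E).filter
        fun c => ∑ j, ∑ e ∈ (E j).erase (c j), w e < 1 : Finset (Fin m → α)) := by
    ext c
    simp
  rw [hset, Set.ncard_coe_finset, div_le_iff₀ (by positivity)]
  calc _ = ∑ c ∈ (Fintype.piFinset E).filter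
          fun c => ∑ j, ∑ e ∈ (E j).erase (c j), w e < 1, (1 : ℝ) := by simp
    _ ≤ ∑ c ∈ (Fintype.piFinset E).filter fun c => ∑ j, ∑ e ∈ (E j).erase (c j), w e < 1,
          Real.exp (t * (1 - k)) * ∏ j, Real.exp (t * w (c j)) := by
        refine Finset.sum_le_sum fun c hc => ?_
        rw [Finset.mem_filter, Fintype.mem_piFinset] at hc
        have herase : ∑ j, ∑ e ∈ (E j).erase (c j), w e = k - ∑ j, w (c j) := by
          rw [← htot, ← Finset.sum_sub_distrib]
          exact Finset.sum_congr rfl fun j _ => Finset.sum_erase_eq_sub (hc.1 j)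
        rw [← Real.exp_sum, ← Real.exp_add, ← Finset.mul_sum, ← mul_add]
        exact Real.one_le_exp (mul_nonneg ht0 (by linarith [hc.2]))
    _ ≤ ∑ c ∈ Fintype.piFinset E, Real.exp (t * (1 - k)) * ∏ j, Real.exp (t * w (c j)) :=
        Finset.sum_le_sum_of_subset_of_nonneg (Finset.filter_subset _ _)
          fun c _ _ => by positivity
    _ = Real.exp (t * (1 - k)) * ∏ j, ∑ x ∈ E j, Real.exp (t * w x) := by
        rw [← Finset.mul_sum, Finset.prod_univ_sum]
    _ ≤ Real.exp (t * (1 - k)) * ∏ j, 3 * Real.exp ((t / 3 + t ^ 2 / 8) * ∑ e ∈ E j, w e) := by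
        gcongr with j
        exact hfactor j
    _ = Real.exp (-(2 * (2 * (k : ℝ) / 3 - 1) ^ 2) / k) * 3 ^ m := by
        rw [Finset.prod_mul_distrib, ← Real.exp_sum, ← Finset.mul_sum, htot, mul_left_comm,
          ← Real.exp_add, Finset.prod_const, Finset.card_univ, Fintype.card_fin, mul_comm]
        congr 2
        rw [ht]
        field_simp
        ring
end
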